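/- Suppose the normalised Hamiltonian system admits, at every point z₀ of the domain, formal series solutions y₁(z) = Σ_{k≥−N−1} c_{1,k}(z−z₀)^{k/(MN−1)}, y₂(z) = Σ_{k≥−M−1} c_{2,k}(z−z₀)^{k/(MN−1)} for every admissible pair of leading coefficients c_{1,−N−1}^{MN−1} = −(MN−1)^{−(N+1)}, c_{2,−M−1} = (MN−1)c_{1,−N−1}^M. Let γ̃ be a finite-length curve ending at a movable singularity z_∞ of a solution (y₁, y₂), on which 1/y₁, 1/y₂, and all ratios y₂^k/y₁^l with l(N+1) − k(M+1) ≥ 0 are bounded. Then there exist analytic functions β_{kl}(z), (k,l) ∈ J = {(k,l) ∈ ℕ² : 1 ≤ k ≤ N+1, 1−MN < k(M+1) − l(N+1) < M+N+2}, determined from the α_{ij} and their derivatives, such that the function W(z, y₁, y₂) = y₁^{M+1} + y₂^{N+1} + Σ_{(i,j)∈I'} α_{ij}(z) y₁^i y₂^j + Σ_{(k,l)∈J} β_{kl}(z) y₂^k / y₁^l is bounded on γ̃. -/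

import Mathlib

open scoped Topology
open Asymptotics Filter

/-- The index set `I = {(i,j) ∈ ℕ² : i(N+1) + j(M+1) < (N+1)(M+1)}`. -/
def idxI (M N : ℕ) : Finset (ℕ × ℕ) :=
  (Finset.range (M + 2) ×ˢ Finset.range (N + 2)).filter
    fun p => p.1 * (N + 1) + p.2 * (M + 1) < (N + 1) * (M + 1)

/-- The index set `I' = I \ {(0,N)}`. -/
def idxI' (M N : ℕ) : Finset (ℕ × ℕ) := (idxI M N).erase (0, N)

/-- The index set `J = {(k,l) ∈ ℕ² : 1 ≤ k ≤ N+1, 1−MN < k(M+1) − l(N+1) < M+N+2}`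
(the constraints force `l ≤ 2M`, so the bounded enumeration below is exhaustive). -/
def idxJ (M N : ℕ) : Finset (ℕ × ℕ) :=
  (Finset.range (N + 2) ×ˢ Finset.range (2 * M + 2)).filter
    fun q => 1 ≤ q.1 ∧
      (1 : ℤ) - (M : ℤ) * N < (q.1 : ℤ) * (M + 1) - (q.2 : ℤ) * (N + 1) ∧
      (q.1 : ℤ) * (M + 1) - (q.2 : ℤ) * (N + 1) < (M : ℤ) + N + 2

/-- Right-hand side of the first equation of the normalised Hamiltonian system. -/
noncomputable def Fn₁ (M N : ℕ) (α : ℕ × ℕ → ℂ → ℂ) (z y₁ y₂ : ℂ) : ℂ :=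
  ((N : ℂ) + 1) * y₂ ^ N +
    ∑ p ∈ idxI' M N, (p.2 : ℂ) * α p z * y₁ ^ p.1 * y₂ ^ (p.2 - 1)

/-- Right-hand side of the second equation of the normalised Hamiltonian system. -/
noncomputable def Fn₂ (M N : ℕ) (α : ℕ × ℕ → ℂ → ℂ) (z y₁ y₂ : ℂ) : ℂ :=
  -(((M : ℂ) + 1) * y₁ ^ M) -
    ∑ p ∈ idxI' M N, (p.1 : ℂ) * α p z * y₁ ^ (p.1 - 1) * y₂ ^ p.2

/-- Truncation of a formal series `∑_{k ≥ k₀} c_k t^k` in the local variable `t`,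
`z = z₀ + t^(MN−1)`, keeping the terms `k₀ ≤ k ≤ k₀ + m`. -/
noncomputable def trunc (k₀ : ℤ) (c : ℤ → ℂ) (m : ℕ) (t : ℂ) : ℂ :=
  ∑ k ∈ Finset.range (m + 1), c (k₀ + k) * t ^ (k₀ + (k : ℤ))

/-- `c₁, c₂` constitute a formal algebraic series solution
`y_i(z) = ∑_k c_{i,k}(z−z₀)^{k/(MN−1)}` of the normalised Hamiltonian system at `z₀`:
the truncations satisfy both equations to arbitrarily high order as `t → 0`. -/
def IsFormalSolution (M N : ℕ) (α : ℕ × ℕ → ℂ → ℂ) (z₀ : ℂ) (c₁ c₂ : ℤ → ℂ) : Prop :=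
  (∀ k : ℤ, k < -((N : ℤ) + 1) → c₁ k = 0) ∧
  (∀ k : ℤ, k < -((M : ℤ) + 1) → c₂ k = 0) ∧
  ∀ e : ℕ, ∃ m : ℕ,
    ((fun t : ℂ =>
        deriv (trunc (-((N : ℤ) + 1)) c₁ m) t -
          ((M * N - 1 : ℕ) : ℂ) * t ^ (M * N - 2) *
            Fn₁ M N α (z₀ + t ^ (M * N - 1))
              (trunc (-((N : ℤ) + 1)) c₁ m t) (trunc (-((M : ℤ) + 1)) c₂ m t))
        =O[𝓝[≠] (0 : ℂ)] fun t => t ^ e) ∧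
    ((fun t : ℂ =>
        deriv (trunc (-((M : ℤ) + 1)) c₂ m) t -
          ((M * N - 1 : ℕ) : ℂ) * t ^ (M * N - 2) *
            Fn₂ M N α (z₀ + t ^ (M * N - 1))
              (trunc (-((N : ℤ) + 1)) c₁ m t) (trunc (-((M : ℤ) + 1)) c₂ m t))
        =O[𝓝[≠] (0 : ℂ)] fun t => t ^ e)


/-- Finite sums of `a(z) y^i x^j` of weight at most `w`. -/
inductive InP (M N : ℕ) (Ω : Set ℂ) (w : ℤ) : (ℂ → ℂ → ℂ → ℂ) → Prop
  | mono (a : ℂ → ℂ) (i : ℤ) (j : ℕ) (ha : AnalyticOnNhd ℂ a Ω)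
      (h : i * ((N : ℤ) + 1) + (j : ℤ) * ((M : ℤ) + 1) ≤ w) :
      InP M N Ω w (fun z y x => a z * y ^ i * x ^ j)
  | zero : InP M N Ω w (fun _ _ _ => 0)
  | add (F G : ℂ → ℂ → ℂ → ℂ) : InP M N Ω w F → InP M N Ω w G →
      InP M N Ω w (fun z y x => F z y x + G z y x)
  | congr (F G : ℂ → ℂ → ℂ → ℂ) : InP M N Ω w F →
      (∀ z ∈ Ω, ∀ y x : ℂ, y ≠ 0 → F z y x = G z y x) → InP M N Ω w G

section basics
variable {M N : ℕ} {Ω : Set ℂ}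

theorem InP.le {w w' : ℤ} {F : ℂ → ℂ → ℂ → ℂ} (h : InP M N Ω w F) (hw : w ≤ w') :
    InP M N Ω w' F := by
  induction h with
  | mono a i j ha h => exact InP.mono a i j ha (h.trans hw)
  | zero => exact InP.zero
  | add F G _ _ h1 h2 => exact InP.add F G h1 h2
  | congr F G _ h h1 => exact InP.congr F G h1 h

theorem InP.mulMono {w w' : ℤ} {F : ℂ → ℂ → ℂ → ℂ} (h : InP M N Ω w F) (a : ℂ → ℂ) (i : ℤ)
    (j : ℕ) (ha : AnalyticOnNhd ℂ a Ω)
    (hw : i * ((N : ℤ) + 1) + (j : ℤ) * ((M : ℤ) + 1) + w ≤ w') :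
    InP M N Ω w' (fun z y x => a z * y ^ i * x ^ j * F z y x) := by
  induction h with
  | mono b i' j' hb h =>
    refine InP.congr (fun z y x => (a z * b z) * y ^ (i + i') * x ^ (j + j')) _
      (InP.mono (fun z => a z * b z) _ _ (ha.mul hb) ?_) ?_
    · push_cast; linarith
    · intro z _ y x hy
      rw [zpow_add₀ hy, pow_add]; ring
  | zero => exact InP.congr _ _ InP.zero (by intros; simp)
  | add F G _ _ h1 h2 =>
    exact InP.congr _ _ (InP.add _ _ h1 h2) (by intros; ring)
  | congr F G _ h h1 =>
    refine InP.congr _ _ h1 ?_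
    intro z hz y x hy
    simp only [h z hz y x hy]

theorem InP.mul {w w' v : ℤ} {F G : ℂ → ℂ → ℂ → ℂ} (h : InP M N Ω w F) (h' : InP M N Ω w' G)
    (hv : w + w' ≤ v) :
    InP M N Ω v (fun z y x => F z y x * G z y x) := by
  induction h with
  | mono b i' j' hb h =>
    exact h'.mulMono b i' j' hb (by linarith)
  | zero => exact InP.congr _ _ InP.zero (by intros; simp)
  | add F G _ _ h1 h2 =>
    exact InP.congr _ _ (InP.add _ _ h1 h2) (by intros; ring)
  | congr F G _ h h1 =>
    refine InP.congr _ _ h1 ?_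
    intro z hz y x hy
    simp only [h z hz y x hy]

theorem InP.cmul {w : ℤ} {F : ℂ → ℂ → ℂ → ℂ} (h : InP M N Ω w F) (c : ℂ) :
    InP M N Ω w (fun z y x => c * F z y x) := by
  refine InP.congr _ _ (h.mulMono (w' := w) (fun _ => c) 0 0 analyticOnNhd_const (by simp)) ?_
  intros; simp

theorem InP.sub {w : ℤ} {F G : ℂ → ℂ → ℂ → ℂ} (h : InP M N Ω w F) (h' : InP M N Ω w G) :
    InP M N Ω w (fun z y x => F z y x - G z y x) :=
  InP.congr _ _ (InP.add _ _ h (h'.cmul (-1))) (by intros; ring)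

theorem InP.sum {ι : Type} {w : ℤ} (s : Finset ι) (F : ι → ℂ → ℂ → ℂ → ℂ)
    (h : ∀ i ∈ s, InP M N Ω w (F i)) :
    InP M N Ω w (fun z y x => ∑ i ∈ s, F i z y x) := by
  classical
  induction s using Finset.induction_on with
  | empty => simpa using InP.zero
  | insert i s hi ih =>
    refine InP.congr _ _ (InP.add _ _ (h i (by simp)) (ih fun j hj => h j (by simp [hj]))) ?_
    intros; rw [Finset.sum_insert hi]

/-- chain rule data -/
def HasPD (Ω : Set ℂ) (F Fz F1 F2 : ℂ → ℂ → ℂ → ℂ) : Prop :=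
  ∀ (ζ η ξ : ℂ → ℂ) (ζ' η' ξ' t : ℂ), ζ t ∈ Ω → η t ≠ 0 →
    HasDerivAt ζ ζ' t → HasDerivAt η η' t → HasDerivAt ξ ξ' t →
    HasDerivAt (fun t => F (ζ t) (η t) (ξ t))
      (Fz (ζ t) (η t) (ξ t) * ζ' + F1 (ζ t) (η t) (ξ t) * η' + F2 (ζ t) (η t) (ξ t) * ξ') t

theorem HasPD.add {F Fz F1 F2 G Gz G1 G2 : ℂ → ℂ → ℂ → ℂ} (h : HasPD Ω F Fz F1 F2)
    (h' : HasPD Ω G Gz G1 G2) :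
    HasPD Ω (fun z y x => F z y x + G z y x) (fun z y x => Fz z y x + Gz z y x)
      (fun z y x => F1 z y x + G1 z y x) (fun z y x => F2 z y x + G2 z y x) := by
  intro ζ η ξ ζ' η' ξ' t h1 h2 h3 h4 h5
  refine ((h ζ η ξ ζ' η' ξ' t h1 h2 h3 h4 h5).add
    (h' ζ η ξ ζ' η' ξ' t h1 h2 h3 h4 h5)).congr_deriv ?_
  ring

theorem HasPD.sum {ι : Type} (s : Finset ι) (F Fz F1 F2 : ι → ℂ → ℂ → ℂ → ℂ)
    (h : ∀ i ∈ s, HasPD Ω (F i) (Fz i) (F1 i) (F2 i)) :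
    HasPD Ω (fun z y x => ∑ i ∈ s, F i z y x) (fun z y x => ∑ i ∈ s, Fz i z y x)
      (fun z y x => ∑ i ∈ s, F1 i z y x) (fun z y x => ∑ i ∈ s, F2 i z y x) := by
  intro ζ η ξ ζ' η' ξ' t h1 h2 h3 h4 h5
  refine (HasDerivAt.fun_sum fun i hi => h i hi ζ η ξ ζ' η' ξ' t h1 h2 h3 h4 h5).congr_deriv ?_
  simp only [Finset.sum_add_distrib, Finset.sum_mul]

theorem HasPD.zmono (a : ℂ → ℂ) (ha : AnalyticOnNhd ℂ a Ω) (i : ℤ) (j : ℕ) :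
    HasPD Ω (fun z y x => a z * y ^ i * x ^ j) (fun z y x => deriv a z * y ^ i * x ^ j)
      (fun z y x => a z * ((i : ℂ) * y ^ (i - 1)) * x ^ j)
      (fun z y x => a z * y ^ i * ((j : ℂ) * x ^ (j - 1))) := by
  intro ζ η ξ ζ' η' ξ' t h1 h2 h3 h4 h5
  have e1 : HasDerivAt (fun t => a (ζ t)) (deriv a (ζ t) * ζ') t :=
    (ha _ h1).differentiableAt.hasDerivAt.comp t h3
  have e2 : HasDerivAt (fun t => η t ^ i) ((i : ℂ) * η t ^ (i - 1) * η') t :=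
    (hasDerivAt_zpow i (η t) (Or.inl h2)).comp t h4
  have e3 := h5.fun_pow j
  refine ((e1.mul e2).mul e3).congr_deriv ?_
  simp only [Pi.mul_apply]
  ring

theorem HasPD.nmono (a : ℂ → ℂ) (ha : AnalyticOnNhd ℂ a Ω) (i : ℕ) (j : ℕ) :
    HasPD Ω (fun z y x => a z * y ^ i * x ^ j) (fun z y x => deriv a z * y ^ i * x ^ j)
      (fun z y x => a z * ((i : ℂ) * y ^ (i - 1)) * x ^ j)
      (fun z y x => a z * y ^ i * ((j : ℂ) * x ^ (j - 1))) := by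
  intro ζ η ξ ζ' η' ξ' t h1 h2 h3 h4 h5
  have e1 : HasDerivAt (fun t => a (ζ t)) (deriv a (ζ t) * ζ') t :=
    (ha _ h1).differentiableAt.hasDerivAt.comp t h3
  have e2 := h4.fun_pow i
  have e3 := h5.fun_pow j
  refine ((e1.mul e2).mul e3).congr_deriv ?_
  simp only [Pi.mul_apply]
  ring

end basics

noncomputable def Wf (M N : ℕ) (α β : ℕ × ℕ → ℂ → ℂ) (z y x : ℂ) : ℂ :=
  y ^ (M + 1) + x ^ (N + 1) + (∑ p ∈ idxI' M N, α p z * y ^ p.1 * x ^ p.2) +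
    ∑ q ∈ idxJ M N, β q z * y ^ (-(q.2 : ℤ)) * x ^ q.1

noncomputable def Wz (M N : ℕ) (α β : ℕ × ℕ → ℂ → ℂ) (z y x : ℂ) : ℂ :=
  (∑ p ∈ idxI' M N, deriv (α p) z * y ^ p.1 * x ^ p.2) +
    ∑ q ∈ idxJ M N, deriv (β q) z * y ^ (-(q.2 : ℤ)) * x ^ q.1

noncomputable def W1 (M N : ℕ) (α β : ℕ × ℕ → ℂ → ℂ) (z y x : ℂ) : ℂ :=
  -Fn₂ M N α z y x +
    ∑ q ∈ idxJ M N, β q z * (((-(q.2 : ℤ) : ℤ) : ℂ) * y ^ (-(q.2 : ℤ) - 1)) * x ^ q.1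

noncomputable def W2 (M N : ℕ) (α β : ℕ × ℕ → ℂ → ℂ) (z y x : ℂ) : ℂ :=
  Fn₁ M N α z y x +
    ∑ q ∈ idxJ M N, β q z * y ^ (-(q.2 : ℤ)) * ((q.1 : ℂ) * x ^ (q.1 - 1))

/-- derivative along the flow of `b y^{-l} x^k` -/
noncomputable def Tq (M N : ℕ) (α : ℕ × ℕ → ℂ → ℂ) (b : ℂ → ℂ) (q : ℕ × ℕ) (z y x : ℂ) : ℂ :=
  deriv b z * y ^ (-(q.2 : ℤ)) * x ^ q.1 +
    b z * (((-(q.2 : ℤ) : ℤ) : ℂ) * y ^ (-(q.2 : ℤ) - 1)) * x ^ q.1 * Fn₁ M N α z y x +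
    b z * y ^ (-(q.2 : ℤ)) * ((q.1 : ℂ) * x ^ (q.1 - 1)) * Fn₂ M N α z y x

noncomputable def DW (M N : ℕ) (α β : ℕ × ℕ → ℂ → ℂ) (z y x : ℂ) : ℂ :=
  (∑ p ∈ idxI' M N, deriv (α p) z * y ^ p.1 * x ^ p.2) +
    ∑ q ∈ idxJ M N, Tq M N α (β q) q z y x

theorem DW_eq (M N : ℕ) (α β : ℕ × ℕ → ℂ → ℂ) (z y x : ℂ) :
    Wz M N α β z y x + W1 M N α β z y x * Fn₁ M N α z y x + W2 M N α β z y x * Fn₂ M N α z y x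
      = DW M N α β z y x := by
  unfold Wz W1 W2 DW Tq
  simp only [Finset.sum_add_distrib, ← Finset.sum_mul]
  ring

section
variable {M N : ℕ} {Ω : Set ℂ} {α β : ℕ × ℕ → ℂ → ℂ}

theorem Wf_hasPD (hα : ∀ p ∈ idxI' M N, AnalyticOnNhd ℂ (α p) Ω)
    (hβ : ∀ q, AnalyticOnNhd ℂ (β q) Ω) :
    HasPD Ω (Wf M N α β) (Wz M N α β) (W1 M N α β) (W2 M N α β) := by
  have h1 := HasPD.nmono (Ω := Ω) (fun _ => 1) analyticOnNhd_const (M + 1) 0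
  have h2 := HasPD.nmono (Ω := Ω) (fun _ => 1) analyticOnNhd_const 0 (N + 1)
  have h3 := HasPD.sum (Ω := Ω) (idxI' M N) _ _ _ _
    (fun p hp => HasPD.nmono (Ω := Ω) (α p) (hα p hp) p.1 p.2)
  have h4 := HasPD.sum (Ω := Ω) (idxJ M N) _ _ _ _
    (fun q _ => HasPD.zmono (Ω := Ω) (β q) (hβ q) (-(q.2 : ℤ)) q.1)
  have h5 := ((h1.add h2).add h3).add h4
  intro ζ η ξ ζ' η' ξ' t k1 k2 k3 k4 k5
  have := h5 ζ η ξ ζ' η' ξ' t k1 k2 k3 k4 k5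
  have e0 : (fun t => Wf M N α β (ζ t) (η t) (ξ t)) = (fun t => 1 * η t ^ (M + 1) * ξ t ^ 0 +
      1 * η t ^ 0 * ξ t ^ (N + 1) + ∑ i ∈ idxI' M N, α i (ζ t) * η t ^ i.1 * ξ t ^ i.2 +
        ∑ i ∈ idxJ M N, β i (ζ t) * η t ^ (-(i.2 : ℤ)) * ξ t ^ i.1) := by
    funext t; simp [Wf]
  rw [e0]
  refine this.congr_deriv ?_
  have e1 : ∀ z y x : ℂ, Fn₂ M N α z y x = -(((M : ℂ) + 1) * y ^ M) -
      ∑ p ∈ idxI' M N, α p z * ((p.1 : ℂ) * y ^ (p.1 - 1)) * x ^ p.2 := by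
    intro z y x; unfold Fn₂; congr 1; apply Finset.sum_congr rfl; intros; ring
  have e2 : ∀ z y x : ℂ, Fn₁ M N α z y x = (((N : ℂ) + 1) * x ^ N) +
      ∑ p ∈ idxI' M N, α p z * y ^ p.1 * ((p.2 : ℂ) * x ^ (p.2 - 1)) := by
    intro z y x; unfold Fn₁; congr 1; apply Finset.sum_congr rfl; intros; ring
  simp only [Wz, W1, W2, e1, e2, deriv_const', Nat.cast_zero, Nat.cast_add, Nat.cast_one,
    Nat.add_sub_cancel, pow_zero]
  ring

theorem memI' {p : ℕ × ℕ} (hp : p ∈ idxI' M N) :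
    (p.1 : ℤ) * ((N : ℤ) + 1) + (p.2 : ℤ) * ((M : ℤ) + 1) < ((N : ℤ) + 1) * ((M : ℤ) + 1) := by
  simp only [idxI', idxI, Finset.mem_erase, Finset.mem_filter] at hp
  exact_mod_cast hp.2.2

theorem memJ {q : ℕ × ℕ} (hq : q ∈ idxJ M N) : 1 ≤ q.1 ∧
      (1 : ℤ) - (M : ℤ) * N < (q.1 : ℤ) * (M + 1) - (q.2 : ℤ) * (N + 1) ∧
      (q.1 : ℤ) * (M + 1) - (q.2 : ℤ) * (N + 1) < (M : ℤ) + N + 2 := by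
  simp only [idxJ, Finset.mem_filter] at hq
  exact hq.2

theorem Fn₁_low (hα : ∀ p ∈ idxI' M N, AnalyticOnNhd ℂ (α p) Ω) :
    InP M N Ω ((N : ℤ) * (M + 1) - 1)
      (fun z y x => Fn₁ M N α z y x - ((N : ℂ) + 1) * x ^ N) := by
  refine InP.congr _ _ (InP.sum (idxI' M N)
    (fun p z y x => (p.2 : ℂ) * α p z * y ^ p.1 * x ^ (p.2 - 1)) ?_) ?_
  · rintro ⟨i, j⟩ hp
    have h := memI' hp
    rcases j with _ | j
    · exact InP.congr _ _ InP.zero (by intros; simp)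
    · refine InP.congr _ _ (InP.mono (fun z => ((j + 1 : ℕ) : ℂ) * α (i, j + 1) z) (i : ℤ) j
        (analyticOnNhd_const.mul (hα _ hp)) ?_) ?_
      · push_cast at h ⊢; linarith
      · intros; simp
  · intros; unfold Fn₁; ring

theorem Fn₂_low (hα : ∀ p ∈ idxI' M N, AnalyticOnNhd ℂ (α p) Ω) :
    InP M N Ω ((M : ℤ) * (N + 1) - 1)
      (fun z y x => Fn₂ M N α z y x + ((M : ℂ) + 1) * y ^ M) := by
  refine InP.congr _ _ ((InP.sum (idxI' M N)
    (fun p z y x => (p.1 : ℂ) * α p z * y ^ (p.1 - 1) * x ^ p.2) ?_).cmul (-1)) ?_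
  · rintro ⟨i, j⟩ hp
    have h := memI' hp
    rcases i with _ | i
    · exact InP.congr _ _ InP.zero (by intros; simp)
    · refine InP.congr _ _ (InP.mono (fun z => ((i + 1 : ℕ) : ℂ) * α (i + 1, j) z) (i : ℤ) j
        (analyticOnNhd_const.mul (hα _ hp)) ?_) ?_
      · push_cast at h ⊢; linarith
      · intros; simp
  · intros; unfold Fn₂; ring

theorem Fn₁_InP (hα : ∀ p ∈ idxI' M N, AnalyticOnNhd ℂ (α p) Ω) :
    InP M N Ω ((N : ℤ) * (M + 1)) (Fn₁ M N α) := by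
  refine InP.congr _ _ (InP.add _ _ ((Fn₁_low hα).le (by linarith))
    (InP.mono (fun _ => (N : ℂ) + 1) 0 N analyticOnNhd_const (by simp))) ?_
  intros; simp

theorem Fn₂_InP (hα : ∀ p ∈ idxI' M N, AnalyticOnNhd ℂ (α p) Ω) :
    InP M N Ω ((M : ℤ) * (N + 1)) (Fn₂ M N α) := by
  refine InP.congr _ _ (InP.add _ _ ((Fn₂_low hα).le (by linarith))
    (InP.mono (fun _ => -((M : ℂ) + 1)) M 0 analyticOnNhd_const (by simp))) ?_
  intros; simp; ring

theorem Wf_low (hα : ∀ p ∈ idxI' M N, AnalyticOnNhd ℂ (α p) Ω)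
    (hβ : ∀ q, AnalyticOnNhd ℂ (β q) Ω) (hM : 2 ≤ M) (hN : 2 ≤ N) :
    InP M N Ω (((N : ℤ) + 1) * (M + 1) - 1)
      (fun z y x => Wf M N α β z y x - y ^ (M + 1) - x ^ (N + 1)) := by
  refine InP.congr _ _ (InP.add _ _ (InP.sum (idxI' M N)
    (fun p z y x => α p z * y ^ (p.1 : ℤ) * x ^ p.2) ?_) (InP.sum (idxJ M N)
    (fun q z y x => β q z * y ^ (-(q.2 : ℤ)) * x ^ q.1) ?_)) ?_
  · intro p hp
    have h := memI' hp
    exact InP.mono _ _ _ (hα p hp) (by linarith)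
  · intro q hq
    have h := memJ hq
    refine InP.mono _ _ _ (hβ q) ?_
    have : (4 : ℤ) ≤ M * N := by exact_mod_cast Nat.mul_le_mul hM hN
    linarith [h.2.2]
  · intros; simp [Wf]; ring

theorem Wf_InP (hα : ∀ p ∈ idxI' M N, AnalyticOnNhd ℂ (α p) Ω)
    (hβ : ∀ q, AnalyticOnNhd ℂ (β q) Ω) (hM : 2 ≤ M) (hN : 2 ≤ N) :
    InP M N Ω (((N : ℤ) + 1) * (M + 1)) (Wf M N α β) := by
  refine InP.congr _ _ (InP.add _ _ (InP.add _ _ ((Wf_low hα hβ hM hN).le (by linarith))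
    (InP.mono (fun _ => 1) ((M + 1 : ℕ) : ℤ) 0 analyticOnNhd_const (by push_cast; linarith)))
    (InP.mono (fun _ => 1) 0 (N + 1) analyticOnNhd_const (by push_cast; linarith))) ?_
  intros; simp only [zpow_natCast]; simp; ring

theorem W1_InP (hα : ∀ p ∈ idxI' M N, AnalyticOnNhd ℂ (α p) Ω)
    (hβ : ∀ q, AnalyticOnNhd ℂ (β q) Ω) (hM : 2 ≤ M) (hN : 2 ≤ N) :
    InP M N Ω (((N : ℤ) + 1) * (M + 1)) (W1 M N α β) := by
  refine InP.congr _ _ (InP.add _ _ (((Fn₂_InP hα).cmul (-1)).le (by linarith))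
    (InP.sum (idxJ M N)
    (fun q z y x => (β q z * ((-(q.2 : ℤ) : ℤ) : ℂ)) * y ^ (-(q.2 : ℤ) - 1) * x ^ q.1) ?_)) ?_
  · intro q hq
    have h := memJ hq
    refine InP.mono (fun z => β q z * ((-(q.2 : ℤ) : ℤ) : ℂ)) _ _
      ((hβ q).mul analyticOnNhd_const) ?_
    have : (4 : ℤ) ≤ M * N := by exact_mod_cast Nat.mul_le_mul hM hN
    linarith [h.2.2]
  · intros; unfold W1; simp only [mul_assoc]; ring

theorem W2_InP (hα : ∀ p ∈ idxI' M N, AnalyticOnNhd ℂ (α p) Ω)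
    (hβ : ∀ q, AnalyticOnNhd ℂ (β q) Ω) (hM : 2 ≤ M) (hN : 2 ≤ N) :
    InP M N Ω (((N : ℤ) + 1) * (M + 1)) (W2 M N α β) := by
  refine InP.congr _ _ (InP.add _ _ ((Fn₁_InP hα).le (by linarith))
    (InP.sum (idxJ M N)
    (fun q z y x => (β q z * (q.1 : ℂ)) * y ^ (-(q.2 : ℤ)) * x ^ (q.1 - 1)) ?_)) ?_
  · intro q hq
    have h := memJ hq
    refine InP.mono (fun z => β q z * (q.1 : ℂ)) _ _
      ((hβ q).mul analyticOnNhd_const) ?_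
    have : (4 : ℤ) ≤ M * N := by exact_mod_cast Nat.mul_le_mul hM hN
    rw [Nat.cast_sub h.1]
    push_cast
    linarith [h.2.2]
  · intros; unfold W2; congr 1; apply Finset.sum_congr rfl; intros; ring

end

def wq (M N : ℕ) (q : ℕ × ℕ) : ℤ := (q.1 : ℤ) * (M + 1) - (q.2 : ℤ) * (N + 1)

noncomputable def resSum (M N : ℕ) (n : ℤ) (e : ℕ × ℕ → ℂ → ℂ) (z y x : ℂ) : ℂ :=
  ∑ q ∈ idxJ M N, if wq M N q = n - ((M : ℤ) * N - 1) then
    e q z * y ^ ((M : ℤ) - q.2) * x ^ (q.1 - 1) else 0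

def NF (M N : ℕ) (Ω : Set ℂ) (W : ℂ → ℂ → ℂ → ℂ) (n : ℤ) (E : ℂ → ℂ → ℂ → ℂ) : Prop :=
  ∃ (e : ℕ × ℕ → ℂ → ℂ) (a : ℂ → ℂ → ℂ → ℂ), (∀ q, AnalyticOnNhd ℂ (e q) Ω) ∧
    InP M N Ω (-1) a ∧
    InP M N Ω (n - 1) (fun z y x => E z y x - a z y x * W z y x - resSum M N n e z y x)

section
variable {M N : ℕ} {Ω : Set ℂ} {α β : ℕ × ℕ → ℂ → ℂ} {W : ℂ → ℂ → ℂ → ℂ} {n : ℤ}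

theorem NF.of_low {E : ℂ → ℂ → ℂ → ℂ} (h : InP M N Ω (n - 1) E) : NF M N Ω W n E := by
  refine ⟨fun _ _ => 0, fun _ _ _ => 0, fun _ => analyticOnNhd_const, InP.zero, ?_⟩
  exact InP.congr _ _ h (by intros; simp [resSum])

theorem NF.add {E F : ℂ → ℂ → ℂ → ℂ} (h : NF M N Ω W n E) (h' : NF M N Ω W n F) :
    NF M N Ω W n (fun z y x => E z y x + F z y x) := by
  obtain ⟨e, a, he, ha, hE⟩ := h
  obtain ⟨e', a', he', ha', hE'⟩ := h'
  refine ⟨fun q z => e q z + e' q z, _, fun q => (he q).add (he' q), InP.add _ _ ha ha', ?_⟩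
  refine InP.congr _ _ (InP.add _ _ hE hE') ?_
  intro z _ y x _
  have : resSum M N n (fun q z => e q z + e' q z) z y x
      = resSum M N n e z y x + resSum M N n e' z y x := by
    unfold resSum
    rw [← Finset.sum_add_distrib]
    apply Finset.sum_congr rfl
    intro q _
    split_ifs <;> ring
  rw [this]; ring

theorem NF.congr {E F : ℂ → ℂ → ℂ → ℂ} (h : NF M N Ω W n E)
    (hEF : ∀ z ∈ Ω, ∀ y x : ℂ, y ≠ 0 → E z y x = F z y x) : NF M N Ω W n F := by
  obtain ⟨e, a, he, ha, hE⟩ := h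
  refine ⟨e, a, he, ha, InP.congr _ _ hE ?_⟩
  intro z hz y x hy
  rw [hEF z hz y x hy]

theorem NF.mulW {a : ℂ → ℂ → ℂ → ℂ} (h : InP M N Ω (-1) a) :
    NF M N Ω W n (fun z y x => a z y x * W z y x) :=
  ⟨fun _ _ => 0, a, fun _ => analyticOnNhd_const, h,
    InP.congr _ _ InP.zero (by intros; simp [resSum])⟩

theorem NF.base (hn : 1 ≤ n) (hn' : n < ((N : ℤ) + 1) * (M + 1))
    (i : ℤ) (j : ℕ) (hj : j ≤ N) (a : ℂ → ℂ) (ha : AnalyticOnNhd ℂ a Ω)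
    (hij : i * ((N : ℤ) + 1) + (j : ℤ) * ((M : ℤ) + 1) = n) :
    NF M N Ω W n (fun z y x => a z * y ^ i * x ^ j) := by
  have hiM : i ≤ M := by
    by_contra hc
    push Not at hc
    have h1 : ((M : ℤ) + 1) * (N + 1) ≤ i * (N + 1) :=
      mul_le_mul_of_nonneg_right (by linarith) (by positivity)
    have h2 : (0 : ℤ) ≤ (j : ℤ) * (M + 1) := by positivity
    linarith
  obtain ⟨l, hl⟩ := Int.eq_ofNat_of_zero_le (sub_nonneg.mpr hiM)
  have hil : i = (M : ℤ) - l := by linarith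
  subst hil
  have hj' : (j : ℤ) ≤ N := by exact_mod_cast hj
  have hw : wq M N (j + 1, l) = n - ((M : ℤ) * N - 1) := by
    simp only [wq]; push_cast; rw [← hij]; ring
  have hmem : (j + 1, l) ∈ idxJ M N := by
    have hw' := hw
    simp only [wq] at hw'
    simp only [idxJ, Finset.mem_filter, Finset.mem_product, Finset.mem_range]
    refine ⟨⟨by omega, ?_⟩, by omega, ?_, ?_⟩
    · by_contra hc
      push Not at hc
      have hc' : (2 * (M : ℤ) + 2) ≤ l := by exact_mod_cast hc
      have h1 : (2 * (M : ℤ) + 2) * (N + 1) ≤ l * (N + 1) :=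
        mul_le_mul_of_nonneg_right hc' (by positivity)
      have h2 : (j : ℤ) * (M + 1) ≤ N * (M + 1) :=
        mul_le_mul_of_nonneg_right hj' (by positivity)
      have h3 : (0 : ℤ) ≤ (M : ℤ) := by positivity
      have h4 : (0 : ℤ) ≤ (N : ℤ) := by positivity
      linarith
    · linarith
    · linarith
  refine ⟨fun q z => if q = (j + 1, l) then a z else 0, fun _ _ _ => 0, ?_, InP.zero, ?_⟩
  · intro q
    by_cases hq : q = (j + 1, l)
    · simpa [hq] using ha
    · simpa [hq] using analyticOnNhd_const
  · refine InP.congr _ _ InP.zero ?_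
    intro z _ y x _
    have : resSum M N n (fun q z => if q = (j + 1, l) then a z else 0) z y x
        = a z * y ^ ((M : ℤ) - l) * x ^ j := by
      unfold resSum
      rw [Finset.sum_eq_single_of_mem _ hmem]
      · rw [if_pos hw]; simp
      · intro q _ hq
        simp [hq]
    rw [this]; ring

theorem NF.mono (hW : InP M N Ω (((N : ℤ) + 1) * (M + 1) - 1)
      (fun z y x => W z y x - y ^ (M + 1) - x ^ (N + 1)))
    (hn : 1 ≤ n) (hn' : n < ((N : ℤ) + 1) * (M + 1)) (j : ℕ) :
    ∀ (i : ℤ) (a : ℂ → ℂ), AnalyticOnNhd ℂ a Ω →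
    i * ((N : ℤ) + 1) + (j : ℤ) * ((M : ℤ) + 1) = n →
    NF M N Ω W n (fun z y x => a z * y ^ i * x ^ j) := by
  induction j using Nat.strong_induction_on with
  | _ j ih =>
  intro i a ha hij
  by_cases hj : j ≤ N
  · exact NF.base hn hn' i j hj a ha hij
  · push Not at hj
    obtain ⟨j', rfl⟩ : ∃ j', j = j' + (N + 1) := ⟨j - (N + 1), by omega⟩
    push_cast at hij
    have h1 := ih j' (by omega) (i + (M + 1)) (fun z => -1 * a z) (analyticOnNhd_const.mul ha)
      (by linarith)
    have h2 : NF M N Ω W n _ := NF.mulW (InP.mono a i j' ha (by linarith))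
    have h3 : NF M N Ω W n _ := NF.of_low
      ((hW.mulMono (w' := n - 1) a i j' ha (by linarith)).cmul (-1))
    refine ((h1.add h2).add h3).congr ?_
    intro z _ y x hy
    have : y ^ (i + ((M : ℤ) + 1)) = y ^ i * y ^ (M + 1) := by
      rw [zpow_add₀ hy]; norm_cast
    rw [this, pow_add x]
    ring

theorem NF.of_InP (hW : InP M N Ω (((N : ℤ) + 1) * (M + 1) - 1)
      (fun z y x => W z y x - y ^ (M + 1) - x ^ (N + 1)))
    (hn : 1 ≤ n) (hn' : n < ((N : ℤ) + 1) * (M + 1)) {E : ℂ → ℂ → ℂ → ℂ}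
    (hE : InP M N Ω n E) : NF M N Ω W n E := by
  induction hE with
  | mono a i j ha h =>
    rcases h.lt_or_eq with h | h
    · exact NF.of_low (InP.mono a i j ha (by linarith))
    · exact NF.mono hW hn hn' j i a ha h
  | zero => exact NF.of_low InP.zero
  | add F G _ _ h1 h2 => exact h1.add h2
  | congr F G _ h h1 => exact h1.congr h

def InvW (M N : ℕ) (Ω : Set ℂ) (α : ℕ × ℕ → ℂ → ℂ) (n : ℤ) (β : ℕ × ℕ → ℂ → ℂ) : Prop :=
  (∀ q, AnalyticOnNhd ℂ (β q) Ω) ∧ ∃ a E, InP M N Ω (-1) a ∧ InP M N Ω n E ∧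
    ∀ z ∈ Ω, ∀ y x : ℂ, y ≠ 0 →
      DW M N α β z y x = a z y x * Wf M N α β z y x + E z y x

theorem InvW.base (hα : ∀ p ∈ idxI' M N, AnalyticOnNhd ℂ (α p) Ω) :
    InvW M N Ω α (((N : ℤ) + 1) * (M + 1) - 1) (fun _ _ => 0) := by
  refine ⟨fun _ => analyticOnNhd_const, fun _ _ _ => 0, _, InP.zero,
    InP.sum (idxI' M N) (fun p z y x => deriv (α p) z * y ^ (p.1 : ℤ) * x ^ p.2) ?_, ?_⟩
  · intro p hp
    have := memI' hp
    exact InP.mono _ _ _ (hα p hp).deriv (by linarith)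
  · intro z hz y x hy
    simp [DW, Tq]

/-- The key computation for one monomial. -/
theorem key (hM : 2 ≤ M) (hN : 2 ≤ N)
    (hα : ∀ p ∈ idxI' M N, AnalyticOnNhd ℂ (α p) Ω)
    (hW : InP M N Ω (((N : ℤ) + 1) * (M + 1) - 1)
      (fun z y x => W z y x - y ^ (M + 1) - x ^ (N + 1)))
    (d : ℂ → ℂ) (hd : AnalyticOnNhd ℂ d Ω) (q : ℕ × ℕ) (hq : 1 ≤ q.1)
    (hqn : wq M N q = n - ((M : ℤ) * N - 1)) :
    InP M N Ω (n - 1) (fun z y x => Tq M N α d q z y x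
      + (wq M N q : ℂ) * d z * y ^ ((M : ℤ) - q.2) * x ^ (q.1 - 1)
      + ((q.2 : ℂ) * (N + 1) * d z) * y ^ (-(q.2 : ℤ) - 1) * x ^ (q.1 - 1) * W z y x) := by
  obtain ⟨k, l⟩ := q
  obtain ⟨k, rfl⟩ : ∃ k', k = k' + 1 := ⟨k - 1, by simp at hq; omega⟩
  have h4 : (4 : ℤ) ≤ M * N := by exact_mod_cast Nat.mul_le_mul hM hN
  have hqn' := hqn
  simp only [wq] at hqn'
  push_cast at hqn'
  have t1 : InP M N Ω (n - 1) _ := InP.mono (deriv d) (-(l : ℤ)) (k + 1) hd.deriv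
    (by push_cast; linarith)
  have t2 := (Fn₁_low hα).mulMono (w' := n - 1) (fun z => (-(l : ℂ)) * d z) (-(l : ℤ) - 1) (k + 1)
    (analyticOnNhd_const.mul hd) (by push_cast; linarith)
  have t3 := (Fn₂_low hα).mulMono (w' := n - 1) (fun z => ((k : ℂ) + 1) * d z) (-(l : ℤ)) k
    (analyticOnNhd_const.mul hd) (by linarith)
  have t4 := hW.mulMono (w' := n - 1) (fun z => (l : ℂ) * (N + 1) * d z) (-(l : ℤ) - 1) k
    (analyticOnNhd_const.mul hd) (by linarith)
  refine InP.congr _ _ (InP.add _ _ (InP.add _ _ (InP.add _ _ t1 t2) t3) t4) ?_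
  intro z _ y x hy
  have e1 : y ^ ((M : ℤ) - l) = y ^ (-(l : ℤ) - 1) * y ^ (M + 1) := by
    rw [← zpow_natCast y (M + 1), ← zpow_add₀ hy]; congr 1; push_cast; ring
  have e2 : y ^ (-(l : ℤ)) = y ^ (-(l : ℤ) - 1) * y := by
    rw [← zpow_add_one₀ hy]; congr 1; ring
  simp only [Tq, wq, e1, Nat.add_sub_cancel]
  rw [e2]
  push_cast
  ring

theorem InvW.step (hM : 2 ≤ M) (hN : 2 ≤ N)
    (hα : ∀ p ∈ idxI' M N, AnalyticOnNhd ℂ (α p) Ω)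
    (hn : 1 ≤ n) (hn' : n < ((N : ℤ) + 1) * (M + 1))
    (hres : ∀ (β e : ℕ × ℕ → ℂ → ℂ) (a E : ℂ → ℂ → ℂ → ℂ), (∀ q, AnalyticOnNhd ℂ (β q) Ω) →
      (∀ q, AnalyticOnNhd ℂ (e q) Ω) → InP M N Ω (-1) a →
      InP M N Ω ((M : ℤ) * N - 1 - 1) E →
      (∀ z ∈ Ω, ∀ y x : ℂ, y ≠ 0 → DW M N α β z y x = a z y x * Wf M N α β z y x +
        resSum M N ((M : ℤ) * N - 1) e z y x + E z y x) →
      ∀ q ∈ idxJ M N, wq M N q = 0 → ∀ z ∈ Ω, e q z = 0)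
    (h : InvW M N Ω α n β) : ∃ β', InvW M N Ω α (n - 1) β' := by
  obtain ⟨hβ, a, E, ha, hE, hD⟩ := h
  obtain ⟨e, a', he, ha', hE'⟩ := NF.of_InP (Wf_low hα hβ hM hN) hn hn' hE
  have haa := InP.add _ _ ha ha'
  have h4 : (4 : ℤ) ≤ M * N := by exact_mod_cast Nat.mul_le_mul hM hN
  by_cases hnr : n = (M : ℤ) * N - 1
  · have h0 := hres β e _ _ hβ he haa (by rw [← hnr]; exact hE') (by
      intro z hz y x hy
      rw [hD z hz y x hy, hnr]; ring)
    refine ⟨β, hβ, _, _, haa, hE', ?_⟩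
    intro z hz y x hy
    have : resSum M N n e z y x = 0 := by
      apply Finset.sum_eq_zero
      intro q hq
      split_ifs with hw
      · rw [h0 q hq (by rw [hw, hnr]; ring) z hz]; simp
      · rfl
    rw [hD z hz y x hy, this]; ring
  · set δ : ℕ × ℕ → ℂ → ℂ := fun q z =>
      if wq M N q = n - ((M : ℤ) * N - 1) then ((wq M N q : ℂ))⁻¹ * e q z else 0 with hδ
    have hδa : ∀ q, AnalyticOnNhd ℂ (δ q) Ω := by
      intro q
      by_cases hw : wq M N q = n - ((M : ℤ) * N - 1)
      · simpa only [hδ, hw, if_true] using analyticOnNhd_const.mul (he q)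
      · simpa only [hδ, hw, if_false] using analyticOnNhd_const
    set β' : ℕ × ℕ → ℂ → ℂ := fun q z => β q z + δ q z with hβ'
    have hβ'a : ∀ q, AnalyticOnNhd ℂ (β' q) Ω := fun q => (hβ q).add (hδa q)
    set D : ℂ → ℂ → ℂ → ℂ := fun z y x =>
      ∑ q ∈ idxJ M N, δ q z * y ^ (-(q.2 : ℤ)) * x ^ q.1 with hDdef
    have hDin : InP M N Ω (n - ((M : ℤ) * N - 1)) D := by
      refine InP.sum _ (fun q z y x => δ q z * y ^ (-(q.2 : ℤ)) * x ^ q.1) ?_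
      intro q hq
      by_cases hw : wq M N q = n - ((M : ℤ) * N - 1)
      · refine InP.mono _ _ _ (hδa q) ?_
        rw [← hw, wq]; linarith
      · exact InP.congr _ _ InP.zero (by intros; simp [hδ, hw])
    have hWW : ∀ z y x, Wf M N α β' z y x = Wf M N α β z y x + D z y x := by
      intro z y x
      simp only [Wf, hβ', hDdef, add_mul, Finset.sum_add_distrib]
      ring
    have hDD : ∀ z ∈ Ω, ∀ y x, DW M N α β' z y x = DW M N α β z y x +
        ∑ q ∈ idxJ M N, Tq M N α (δ q) q z y x := by
      intro z hz y x
      simp only [DW]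
      rw [add_assoc, ← Finset.sum_add_distrib]
      congr 1
      apply Finset.sum_congr rfl
      intro q _
      have : deriv (β' q) z = deriv (β q) z + deriv (δ q) z :=
        deriv_add (hβ q z hz).differentiableAt (hδa q z hz).differentiableAt
      have hb : β' q z = β q z + δ q z := rfl
      simp only [Tq]
      rw [this, hb]
      ring
    have hWl := Wf_low hα hβ'a hM hN
    -- per-term remainder
    have hsum : InP M N Ω (n - 1) (fun z y x => ∑ q ∈ idxJ M N, (Tq M N α (δ q) q z y x
      + (wq M N q : ℂ) * δ q z * y ^ ((M : ℤ) - q.2) * x ^ (q.1 - 1)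
      + ((q.2 : ℂ) * (N + 1) * δ q z) * y ^ (-(q.2 : ℤ) - 1) * x ^ (q.1 - 1)
        * Wf M N α β' z y x)) := by
      refine InP.sum _ (fun q z y x => (Tq M N α (δ q) q z y x
      + (wq M N q : ℂ) * δ q z * y ^ ((M : ℤ) - q.2) * x ^ (q.1 - 1)
      + ((q.2 : ℂ) * (N + 1) * δ q z) * y ^ (-(q.2 : ℤ) - 1) * x ^ (q.1 - 1)
        * Wf M N α β' z y x)) ?_
      intro q hq
      by_cases hw : wq M N q = n - ((M : ℤ) * N - 1)
      · exact key hM hN hα hWl (δ q) (hδa q) q (memJ hq).1 hw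
      · have : δ q = fun _ => 0 := by funext z; simp [hδ, hw]
        exact InP.congr _ _ InP.zero (by intros; simp [this, Tq])
    have hA : InP M N Ω (-1) (fun z y x => ∑ q ∈ idxJ M N,
        ((q.2 : ℂ) * (N + 1) * δ q z) * y ^ (-(q.2 : ℤ) - 1) * x ^ (q.1 - 1)) := by
      refine InP.sum _ (fun q z y x =>
        ((q.2 : ℂ) * (N + 1) * δ q z) * y ^ (-(q.2 : ℤ) - 1) * x ^ (q.1 - 1)) ?_
      intro q hq
      have := memJ hq
      refine InP.mono (fun z => (q.2 : ℂ) * (N + 1) * δ q z) _ _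
        (analyticOnNhd_const.mul (hδa q)) ?_
      rw [Nat.cast_sub this.1]; push_cast
      linarith [this.2.2]
    refine ⟨β', hβ'a, _, _, haa.sub hA,
      InP.add _ _ (InP.sub hE' (haa.mul (v := n - 1) hDin (by linarith))) hsum, ?_⟩
    intro z hz y x hy
    have hr : resSum M N n e z y x = ∑ q ∈ idxJ M N,
        (wq M N q : ℂ) * δ q z * y ^ ((M : ℤ) - q.2) * x ^ (q.1 - 1) := by
      apply Finset.sum_congr rfl
      intro q _
      by_cases hw : wq M N q = n - ((M : ℤ) * N - 1)
      · have hne : (wq M N q : ℂ) ≠ 0 := by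
          rw [Int.cast_ne_zero, hw]
          intro h; apply hnr; linarith
        simp only [hδ]
        rw [if_pos hw, if_pos hw, mul_inv_cancel_left₀ hne]
      · simp [hδ, hw]
    simp only [Finset.sum_add_distrib, ← Finset.sum_mul]
    rw [hDD z hz, hD z hz y x hy, ← hr, hWW]
    ring

end

theorem resonance_alg (M N : ℕ) (hM : 2 ≤ M) (hN : 2 ≤ N) (v : ℕ × ℕ → ℂ)
    (h : ∀ c : ℂ, c ^ (M * N - 1) = -(((M * N - 1 : ℕ) : ℂ) ^ (N + 1))⁻¹ →
      ∑ q ∈ idxJ M N, (if wq M N q = 0 then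
        v q * c ^ ((M : ℤ) - q.2) * (((M * N - 1 : ℕ) : ℂ) * c ^ M) ^ (q.1 - 1) else 0) = 0) :
    ∀ q ∈ idxJ M N, wq M N q = 0 → v q = 0 := by
  have hMN : 4 ≤ M * N := Nat.mul_le_mul hM hN
  set Q : ℕ := M * N - 1 with hQ
  have hQ0 : (Q : ℂ) ≠ 0 := by exact_mod_cast (by omega : Q ≠ 0)
  set κ : ℂ := -((Q : ℂ) ^ (N + 1))⁻¹ with hκ
  have hκ0 : κ ≠ 0 := neg_ne_zero.mpr (inv_ne_zero (pow_ne_zero _ hQ0))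
  obtain ⟨d, m', n', hd, hco, hm', hn'⟩ := Nat.exists_coprime' (m := M + 1) (n := N + 1)
    (Nat.gcd_pos_of_pos_left _ (by omega))
  have hm'0 : 0 < m' := Nat.pos_of_ne_zero (by rintro rfl; simp at hm')
  have hn'0 : 0 < n' := Nat.pos_of_ne_zero (by rintro rfl; simp at hn')
  -- structure of resonant indices
  have hstr : ∀ q ∈ idxJ M N, wq M N q = 0 → ∃ s, q = (n' * (s + 1), m' * (s + 1)) ∧ s < d := by
    rintro ⟨k, l⟩ hq hw
    have hk := (memJ hq).1
    have hk2 : k ≤ N + 1 := by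
      simp only [idxJ, Finset.mem_filter, Finset.mem_product, Finset.mem_range] at hq
      omega
    have h1 : k * (M + 1) = l * (N + 1) := by
      simp only [wq] at hw
      have : (k : ℤ) * (M + 1) = l * (N + 1) := by linarith
      exact_mod_cast this
    have h2 : k * m' = l * n' := by
      rw [hm', hn'] at h1
      apply Nat.eq_of_mul_eq_mul_right hd
      linarith
    have h3 : n' ∣ k := by
      apply hco.symm.dvd_of_dvd_mul_right
      rw [h2]; exact dvd_mul_left _ _
    obtain ⟨s, rfl⟩ := h3
    have hs : s ≠ 0 := by rintro rfl; simp at hk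
    obtain ⟨s, rfl⟩ := Nat.exists_eq_succ_of_ne_zero hs
    have hl : l = m' * (s + 1) := by
      apply Nat.eq_of_mul_eq_mul_right hn'0
      rw [← h2]; simp only [Nat.succ_eq_add_one]; ring
    refine ⟨s, by rw [hl], ?_⟩
    have : n' * (s + 1) ≤ n' * d := by rw [mul_comm n' d, mul_comm d n', ← hn']; exact hk2
    exact Nat.le_of_mul_le_mul_left this hn'0
  have hQ'eq : Q + d * m' = d * (M * n') := by
    have : d * (M * n') = M * (N + 1) := by rw [hn']; ring
    rw [this, mul_comm d, ← hm', mul_add]; omega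
  have hQ'pos : m' < M * n' := by
    by_contra hc
    push Not at hc
    have := Nat.mul_le_mul_left d hc
    omega
  obtain ⟨Q', hQ'⟩ : ∃ Q', M * n' = m' + Q' := ⟨M * n' - m', by omega⟩
  have hQ'0 : 0 < Q' := by omega
  have hQd : Q = Q' * d := by
    rw [hQ', mul_add] at hQ'eq; linarith
  let P : Polynomial ℂ := ∑ q ∈ idxJ M N, if wq M N q = 0 then
    Polynomial.C (v q * (Q : ℂ) ^ (q.1 - 1)) * Polynomial.X ^ (q.1 / n' - 1) else 0
  have hdeg : P.degree < d := by
    apply (Polynomial.degree_sum_le _ _).trans_lt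
    rw [Finset.sup_lt_iff (by exact_mod_cast WithBot.bot_lt_coe d)]
    intro q hq
    split_ifs with hw
    · obtain ⟨s, rfl, hs⟩ := hstr q hq hw
      refine (Polynomial.degree_C_mul_X_pow_le _ _).trans_lt ?_
      simp only [Nat.mul_div_cancel_left _ hn'0, Nat.add_sub_cancel]
      exact_mod_cast hs
    · rw [Polynomial.degree_zero]; exact WithBot.bot_lt_coe d
  have heval : ∀ x : ℂ, x ^ d = κ → P.eval x = 0 := by
    intro x hx
    obtain ⟨c, hc⟩ := IsAlgClosed.exists_pow_nat_eq x hQ'0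
    have hx0 : x ≠ 0 := by
      rintro rfl
      rw [zero_pow hd.ne'] at hx
      exact hκ0 hx.symm
    have hc0 : c ≠ 0 := by
      rintro rfl
      rw [zero_pow hQ'0.ne'] at hc
      exact hx0 hc.symm
    have h1 := h c (by rw [hQd, pow_mul, hc, hx])
    have h2 : x * P.eval x = 0 := by
      rw [← h1, Polynomial.eval_finsetSum, Finset.mul_sum]
      apply Finset.sum_congr rfl
      intro q hq
      split_ifs with hw
      · obtain ⟨s, rfl, hs⟩ := hstr q hq hw
        simp only [Nat.mul_div_cancel_left _ hn'0, Nat.add_sub_cancel, Polynomial.eval_mul,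
          Polynomial.eval_C, Polynomial.eval_pow, Polynomial.eval_X]
        rw [mul_pow, ← hc]
        have : c ^ ((M : ℤ) - (m' * (s + 1) : ℕ)) * (c ^ M) ^ (n' * (s + 1) - 1)
            = c ^ Q' * (c ^ Q') ^ s := by
          rw [← pow_mul, ← pow_mul, ← pow_add, ← zpow_natCast, ← zpow_natCast, ← zpow_add₀ hc0]
          congr 1
          have hpos : 1 ≤ n' * (s + 1) := Nat.mul_pos hn'0 (by omega)
          push_cast [Nat.cast_sub hpos]
          have : (M : ℤ) * n' = m' + Q' := by exact_mod_cast hQ'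
          linear_combination ((s : ℤ) + 1) * this
        linear_combination (-(v (n' * (s + 1), m' * (s + 1)) * (Q : ℂ) ^ (n' * (s + 1) - 1))) * this
      · simp
    exact (mul_eq_zero.mp h2).resolve_left hx0
  have hP : P = 0 := by
    have hprim := Complex.isPrimitiveRoot_exp d hd.ne'
    obtain ⟨x0, hx0⟩ := IsAlgClosed.exists_pow_nat_eq κ hd
    have hx00 : x0 ≠ 0 := by
      rintro rfl
      rw [zero_pow hd.ne'] at hx0
      exact hκ0 hx0.symm
    refine Polynomial.eq_zero_of_degree_lt_of_eval_finset_eq_zero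
      ((Finset.range d).image fun i => x0 * (Complex.exp (2 * Real.pi * Complex.I / d)) ^ i) ?_ ?_
    · rw [Finset.card_image_of_injOn]
      · simpa using hdeg
      · intro i hi j hj hij
        exact hprim.pow_inj (by simpa using hi) (by simpa using hj) (mul_left_cancel₀ hx00 hij)
    · intro x hx
      simp only [Finset.mem_image] at hx
      obtain ⟨i, _, rfl⟩ := hx
      apply heval
      rw [mul_pow, hx0, ← pow_mul, mul_comm i, pow_mul, hprim.pow_eq_one]; simp
  intro q hq hw
  obtain ⟨s, rfl, hs⟩ := hstr q hq hw
  have hcoef : P.coeff s = v (n' * (s + 1), m' * (s + 1)) * (Q : ℂ) ^ (n' * (s + 1) - 1) := by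
    rw [Polynomial.finsetSum_coeff, Finset.sum_eq_single_of_mem _ hq]
    · rw [if_pos hw]
      simp only [Nat.mul_div_cancel_left _ hn'0, Nat.add_sub_cancel, Polynomial.coeff_C_mul,
        Polynomial.coeff_X_pow, if_true, mul_one]
    · intro q hq' hne
      split_ifs with hw'
      · obtain ⟨s', rfl, hs'⟩ := hstr q hq' hw'
        simp only [Nat.mul_div_cancel_left _ hn'0, Nat.add_sub_cancel, Polynomial.coeff_C_mul,
          Polynomial.coeff_X_pow]
        rw [if_neg, mul_zero]
        rintro rfl
        exact hne rfl
      · simp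
  rw [hP, Polynomial.coeff_zero] at hcoef
  exact (mul_eq_zero.mp hcoef.symm).resolve_right (pow_ne_zero _ hQ0)

theorem residue_zero {w b σ : ℂ → ℂ} {S : ℂ} (hw : MeromorphicAt w 0)
    (heq : ∀ᶠ t in 𝓝[≠] (0 : ℂ), t * deriv w t = b t * w t + σ t)
    (hb : Tendsto b (𝓝[≠] 0) (𝓝 0)) (hσ : Tendsto σ (𝓝[≠] 0) (𝓝 S)) : S = 0 := by
  have hid : Tendsto (fun t : ℂ => t) (𝓝[≠] 0) (𝓝 0) := tendsto_nhdsWithin_of_tendsto_nhds tendsto_id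
  have key : ∀ {f g : ℂ → ℂ}, f =ᶠ[𝓝[≠] (0 : ℂ)] g → ∀ᶠ t in 𝓝[≠] (0 : ℂ), deriv f t = deriv g t := by
    intro f g hfg
    have := eventually_eventually_nhdsWithin.2 hfg
    filter_upwards [this, self_mem_nhdsWithin] with t ht ht0
    have : f =ᶠ[𝓝 t] g := by
      have h2 : 𝓝[{(0 : ℂ)}ᶜ] t = 𝓝 t := isOpen_compl_singleton.nhdsWithin_eq ht0
      rw [h2] at ht; exact ht
    exact this.deriv_eq
  by_cases htop : meromorphicOrderAt w 0 = ⊤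
  · rw [meromorphicOrderAt_eq_top_iff] at htop
    have h1 := key (g := fun _ => 0) htop
    have : σ =ᶠ[𝓝[≠] 0] fun _ => 0 := by
      filter_upwards [heq, h1, htop] with t h h' h''
      rw [h', h''] at h; simpa using h.symm
    exact tendsto_nhds_unique hσ (tendsto_const_nhds.congr' this.symm)
  · obtain ⟨h, hh, hh0, hwh⟩ := (meromorphicOrderAt_ne_top_iff hw).1 htop
    set p : ℤ := (meromorphicOrderAt w 0).untop₀ with hp
    have hwh' : w =ᶠ[𝓝[≠] 0] fun t => t ^ p * h t := by
      filter_upwards [hwh] with t ht; simpa using ht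
    have hd := key hwh'
    have hhd : ∀ᶠ t in 𝓝[≠] (0 : ℂ), DifferentiableAt ℂ h t :=
      (hh.eventually_analyticAt.mono fun t ht => ht.differentiableAt).filter_mono nhdsWithin_le_nhds
    have hlim : Tendsto h (𝓝[≠] 0) (𝓝 (h 0)) := hh.continuousAt.continuousWithinAt
    have hlim' : Tendsto (deriv h) (𝓝[≠] 0) (𝓝 (deriv h 0)) :=
      hh.deriv.continuousAt.continuousWithinAt
    -- main identity
    have hmain : ∀ᶠ t in 𝓝[≠] (0 : ℂ),
        t ^ p * (p * h t + t * deriv h t - b t * h t) = σ t := by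
      filter_upwards [heq, hwh', hd, hhd, self_mem_nhdsWithin] with t h1 h2 h3 h4 h5
      have h5' : t ≠ 0 := h5
      have e1 : deriv (fun t => t ^ p * h t) t = (p * t ^ (p - 1)) * h t + t ^ p * deriv h t :=
        ((hasDerivAt_zpow p t (Or.inl h5')).mul h4.hasDerivAt).deriv
      rw [h3, e1, h2] at h1
      have e2 : t * t ^ (p - 1) = t ^ p := by
        rw [mul_comm, ← zpow_add_one₀ h5']; congr 1; ring
      linear_combination h1 - (p : ℂ) * h t * e2
    have hbr : Tendsto (fun t => p * h t + t * deriv h t - b t * h t) (𝓝[≠] 0)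
        (𝓝 (p * h 0 + 0 * deriv h 0 - 0 * h 0)) :=
      ((tendsto_const_nhds.mul hlim).add (hid.mul hlim')).sub (hb.mul hlim)
    rcases lt_trichotomy p 0 with hneg | hzero | hpos
    · exfalso
      obtain ⟨r, hr⟩ := Int.eq_ofNat_of_zero_le (by linarith : 0 ≤ -p)
      have hr0 : r ≠ 0 := by rintro rfl; simp at hr; linarith
      have : Tendsto (fun t => t ^ r * σ t) (𝓝[≠] 0) (𝓝 (0 ^ r * S)) := (hid.pow r).mul hσ
      have h2 : (fun t => t ^ r * σ t) =ᶠ[𝓝[≠] 0]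
          fun t => p * h t + t * deriv h t - b t * h t := by
        filter_upwards [hmain, self_mem_nhdsWithin] with t ht h5
        have h5' : t ≠ 0 := h5
        have : t ^ r * t ^ p = 1 := by
          rw [← zpow_natCast, ← zpow_add₀ h5']
          have : (r : ℤ) + p = 0 := by rw [← hr]; ring
          rw [this, zpow_zero]
        rw [← ht, ← mul_assoc, this, one_mul]
      have h3 := tendsto_nhds_unique (hbr.congr' h2.symm) this
      rw [zero_pow hr0] at h3
      simp at h3
      rcases h3 with h3 | h3
      · linarith
      · exact hh0 h3
    · rw [hzero] at hmain hbr
      have := tendsto_nhds_unique hσ (hbr.congr' (by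
        filter_upwards [hmain] with t ht; simpa using ht))
      simpa using this
    · obtain ⟨r, hr⟩ := Int.eq_ofNat_of_zero_le hpos.le
      have hr0 : r ≠ 0 := by rintro rfl; simp at hr; linarith
      have h1 := (hid.pow r).mul hbr
      have := tendsto_nhds_unique hσ (h1.congr' (by
        filter_upwards [hmain] with t ht; rw [← ht, hr]; simp))
      rw [zero_pow hr0] at this
      simpa using this

theorem InP.laurent {M N : ℕ} {Ω : Set ℂ} (hΩ : IsOpen Ω) {z₀ : ℂ} (hz₀ : z₀ ∈ Ω) {Q : ℕ} (hQ : Q ≠ 0)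
    {Y₁ Y₂ p₁ p₂ : ℂ → ℂ} (hp₁ : AnalyticAt ℂ p₁ 0) (hp₂ : AnalyticAt ℂ p₂ 0) (hp₁0 : p₁ 0 ≠ 0)
    (hY₁ : ∀ t ≠ 0, Y₁ t = p₁ t * t ^ (-((N : ℤ) + 1)))
    (hY₂ : ∀ t ≠ 0, Y₂ t = p₂ t * t ^ (-((M : ℤ) + 1)))
    {w : ℤ} {F : ℂ → ℂ → ℂ → ℂ} (hF : InP M N Ω w F) :
    ∃ g : ℂ → ℂ, AnalyticAt ℂ g 0 ∧
      ∀ᶠ t in 𝓝[≠] (0 : ℂ), F (z₀ + t ^ Q) (Y₁ t) (Y₂ t) = t ^ (-w) * g t := by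
  have hζ : AnalyticAt ℂ (fun t : ℂ => z₀ + t ^ Q) 0 := by fun_prop
  have hζ0 : z₀ + (0 : ℂ) ^ Q = z₀ := by simp [hQ]
  have hζΩ : ∀ᶠ t in 𝓝[≠] (0 : ℂ), z₀ + t ^ Q ∈ Ω :=
    (hζ.continuousAt.eventually_mem (by rw [hζ0]; exact hΩ.mem_nhds hz₀)).filter_mono
      nhdsWithin_le_nhds
  have hp₁ne : ∀ᶠ t in 𝓝[≠] (0 : ℂ), p₁ t ≠ 0 :=
    (hp₁.continuousAt.eventually_ne hp₁0).filter_mono nhdsWithin_le_nhds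
  induction hF with
  | mono a i j ha h =>
    obtain ⟨r, hr⟩ := Int.eq_ofNat_of_zero_le (sub_nonneg.mpr h)
    refine ⟨fun t => t ^ r * (a (z₀ + t ^ Q) * p₁ t ^ i * p₂ t ^ j), ?_, ?_⟩
    · have h1 : AnalyticAt ℂ (fun t : ℂ => a (z₀ + t ^ Q)) 0 :=
        AnalyticAt.fun_comp (by rw [hζ0]; exact ha z₀ hz₀) hζ
      exact (analyticAt_id.pow r).mul ((h1.mul (hp₁.zpow hp₁0)).mul (hp₂.pow j))
    · filter_upwards [self_mem_nhdsWithin] with t ht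
      have ht' : t ≠ 0 := ht
      rw [hY₁ t ht', hY₂ t ht', mul_zpow, mul_pow, ← zpow_mul, ← zpow_natCast (t ^ _) j, ← zpow_mul]
      have e : t ^ (-((N : ℤ) + 1) * i) * t ^ (-((M : ℤ) + 1) * (j : ℤ)) = t ^ (-w) * t ^ r := by
        rw [← zpow_natCast t r, ← zpow_add₀ ht', ← zpow_add₀ ht', ← hr]
        congr 1; ring
      linear_combination (a (z₀ + t ^ Q) * p₁ t ^ i * p₂ t ^ j) * e
  | zero => exact ⟨fun _ => 0, analyticAt_const, by simp⟩
  | add F G _ _ h1 h2 =>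
    obtain ⟨f, hf, hf'⟩ := h1
    obtain ⟨g, hg, hg'⟩ := h2
    refine ⟨fun t => f t + g t, hf.add hg, ?_⟩
    filter_upwards [hf', hg'] with t h h'
    rw [h, h']; ring
  | congr F G _ h h1 =>
    obtain ⟨f, hf, hf'⟩ := h1
    refine ⟨f, hf, ?_⟩
    filter_upwards [hf', hζΩ, hp₁ne, self_mem_nhdsWithin] with t k1 k2 k3 k4
    rw [← h _ k2 _ _ ?_, k1]
    rw [hY₁ t k4]
    exact mul_ne_zero k3 (zpow_ne_zero _ k4)

noncomputable def tp (k₀ : ℤ) (c : ℤ → ℂ) (m : ℕ) (t : ℂ) : ℂ :=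
  ∑ k ∈ Finset.range (m + 1), c (k₀ + k) * t ^ k

theorem tp_analytic (k₀ : ℤ) (c : ℤ → ℂ) (m : ℕ) (t : ℂ) : AnalyticAt ℂ (tp k₀ c m) t := by
  unfold tp
  fun_prop

theorem tp_zero (k₀ : ℤ) (c : ℤ → ℂ) (m : ℕ) : tp k₀ c m 0 = c k₀ := by
  unfold tp
  rw [Finset.sum_range_succ']
  simp

theorem trunc_eq (k₀ : ℤ) (c : ℤ → ℂ) (m : ℕ) (t : ℂ) (ht : t ≠ 0) :
    trunc k₀ c m t = tp k₀ c m t * t ^ k₀ := by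
  unfold tp trunc
  rw [Finset.sum_mul]
  apply Finset.sum_congr rfl
  intro k _
  rw [zpow_add₀ ht, zpow_natCast]; ring

theorem trunc_diff (k₀ : ℤ) (c : ℤ → ℂ) (m : ℕ) (t : ℂ) (ht : t ≠ 0) :
    DifferentiableAt ℂ (trunc k₀ c m) t := by
  unfold trunc
  refine DifferentiableAt.fun_sum fun k _ => ?_
  exact (differentiableAt_zpow.2 (Or.inl ht)).const_mul _

theorem resonance_zero (M N : ℕ) (hM : 2 ≤ M) (hN : 2 ≤ N)
    (Ω : Set ℂ) (hΩ : IsOpen Ω)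
    (α : ℕ × ℕ → ℂ → ℂ) (hα : ∀ p ∈ idxI' M N, AnalyticOnNhd ℂ (α p) Ω)
    (z₀ : ℂ) (hz₀ : z₀ ∈ Ω) (c₁ c₂ : ℤ → ℂ) (hc₁ : c₁ (-((N : ℤ) + 1)) ≠ 0)
    (hsol : IsFormalSolution M N α z₀ c₁ c₂)
    (β e : ℕ × ℕ → ℂ → ℂ) (a E : ℂ → ℂ → ℂ → ℂ) (hβ : ∀ q, AnalyticOnNhd ℂ (β q) Ω)
    (he : ∀ q, AnalyticOnNhd ℂ (e q) Ω) (ha : InP M N Ω (-1) a)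
    (hE : InP M N Ω ((M : ℤ) * N - 1 - 1) E)
    (hD : ∀ z ∈ Ω, ∀ y x : ℂ, y ≠ 0 → DW M N α β z y x = a z y x * Wf M N α β z y x +
        resSum M N ((M : ℤ) * N - 1) e z y x + E z y x) :
    resSum M N ((M : ℤ) * N - 1) e z₀ (c₁ (-((N : ℤ) + 1))) (c₂ (-((M : ℤ) + 1))) = 0 := by
  have hMN : 4 ≤ M * N := Nat.mul_le_mul hM hN
  obtain ⟨-, -, hs⟩ := hsol
  obtain ⟨m, hs1, hs2⟩ := hs ((N + 1) * (M + 1))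
  obtain ⟨Q, hQ⟩ : ∃ Q, M * N - 1 = Q + 1 := ⟨M * N - 2, by omega⟩
  have hQ2 : M * N - 2 = Q := by omega
  have hQz : (M : ℤ) * N - 1 = (Q : ℤ) + 1 := by
    have : M * N = Q + 2 := by omega
    have : (M : ℤ) * N = Q + 2 := by exact_mod_cast this
    linarith
  rw [hQ, hQ2] at hs1 hs2
  rw [hQz] at hE hD ⊢
  set Y₁ := trunc (-((N : ℤ) + 1)) c₁ m with hY₁
  set Y₂ := trunc (-((M : ℤ) + 1)) c₂ m with hY₂
  set p₁ := tp (-((N : ℤ) + 1)) c₁ m with hp₁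
  set p₂ := tp (-((M : ℤ) + 1)) c₂ m with hp₂
  have hp₁0 : p₁ 0 = c₁ (-((N : ℤ) + 1)) := tp_zero _ _ _
  have hp₂0 : p₂ 0 = c₂ (-((M : ℤ) + 1)) := tp_zero _ _ _
  have hp₁a : AnalyticAt ℂ p₁ 0 := tp_analytic _ _ _ _
  have hp₂a : AnalyticAt ℂ p₂ 0 := tp_analytic _ _ _ _
  have L : ∀ {w : ℤ} {F : ℂ → ℂ → ℂ → ℂ}, InP M N Ω w F → ∃ g : ℂ → ℂ, AnalyticAt ℂ g 0 ∧
      ∀ᶠ t in 𝓝[≠] (0 : ℂ), F (z₀ + t ^ (Q + 1)) (Y₁ t) (Y₂ t) = t ^ (-w) * g t := fun hF =>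
    hF.laurent hΩ hz₀ (Nat.succ_ne_zero Q) hp₁a hp₂a (by rw [hp₁0]; exact hc₁)
      (fun t ht => trunc_eq _ _ _ t ht) (fun t ht => trunc_eq _ _ _ t ht)
  have hζ : AnalyticAt ℂ (fun t : ℂ => z₀ + t ^ (Q + 1)) 0 := by fun_prop
  have hζ0 : z₀ + (0 : ℂ) ^ (Q + 1) = z₀ := by simp
  have hζΩ : ∀ᶠ t in 𝓝[≠] (0 : ℂ), z₀ + t ^ (Q + 1) ∈ Ω :=
    (hζ.continuousAt.eventually_mem (by rw [hζ0]; exact hΩ.mem_nhds hz₀)).filter_mono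
      nhdsWithin_le_nhds
  have hY₁ne : ∀ᶠ t in 𝓝[≠] (0 : ℂ), Y₁ t ≠ 0 := by
    filter_upwards [(hp₁a.continuousAt.eventually_ne (by rw [hp₁0]; exact hc₁)).filter_mono
      nhdsWithin_le_nhds, self_mem_nhdsWithin] with t h1 h2
    rw [hY₁, trunc_eq _ _ _ t h2]
    exact mul_ne_zero h1 (zpow_ne_zero _ h2)
  have hid : Tendsto (fun t : ℂ => t) (𝓝[≠] 0) (𝓝 0) :=
    tendsto_nhdsWithin_of_tendsto_nhds tendsto_id
  obtain ⟨gW, hgW, hgW'⟩ := L (Wf_InP hα hβ hM hN)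
  obtain ⟨gW1, hgW1, hgW1'⟩ := L (W1_InP hα hβ hM hN)
  obtain ⟨gW2, hgW2, hgW2'⟩ := L (W2_InP hα hβ hM hN)
  obtain ⟨ga, hga, hga'⟩ := L ha
  obtain ⟨gE, hgE, hgE'⟩ := L hE
  set w : ℂ → ℂ := fun t => Wf M N α β (z₀ + t ^ (Q + 1)) (Y₁ t) (Y₂ t) with hw
  have hwm : MeromorphicAt w 0 := by
    have h1 : MeromorphicAt (fun t : ℂ => t ^ (-(((N : ℤ) + 1) * (M + 1))) * gW t) 0 :=
      ((MeromorphicAt.id 0).zpow _).mul hgW.meromorphicAt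
    exact h1.congr (by filter_upwards [hgW'] with t ht; rw [hw]; exact ht.symm)
  set err₁ : ℂ → ℂ := fun t => deriv Y₁ t - ((Q + 1 : ℕ) : ℂ) * t ^ Q *
    Fn₁ M N α (z₀ + t ^ (Q + 1)) (Y₁ t) (Y₂ t) with herr₁
  set err₂ : ℂ → ℂ := fun t => deriv Y₂ t - ((Q + 1 : ℕ) : ℂ) * t ^ Q *
    Fn₂ M N α (z₀ + t ^ (Q + 1)) (Y₁ t) (Y₂ t) with herr₂
  have herr : ∀ (V : ℂ → ℂ → ℂ → ℂ) (g err : ℂ → ℂ), AnalyticAt ℂ g 0 →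
      (∀ᶠ t in 𝓝[≠] (0 : ℂ), V (z₀ + t ^ (Q + 1)) (Y₁ t) (Y₂ t) =
        t ^ (-(((N : ℤ) + 1) * (M + 1))) * g t) →
      (err =O[𝓝[≠] (0 : ℂ)] fun t => t ^ ((N + 1) * (M + 1))) →
      Tendsto (fun t => t * (V (z₀ + t ^ (Q + 1)) (Y₁ t) (Y₂ t) * err t)) (𝓝[≠] 0) (𝓝 0) := by
    intro V g err hg hV herr
    have h1 : g =O[𝓝[≠] (0 : ℂ)] fun _ => (1 : ℂ) :=
      (hg.continuousAt.continuousWithinAt (s := {0}ᶜ)).isBigO_one ℂ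
    have h2 : (fun t => V (z₀ + t ^ (Q + 1)) (Y₁ t) (Y₂ t)) =O[𝓝[≠] (0 : ℂ)]
        fun t => t ^ (-(((N : ℤ) + 1) * (M + 1))) * 1 :=
      ((isBigO_refl (fun t : ℂ => t ^ (-(((N : ℤ) + 1) * (M + 1)))) _).mul h1).congr'
        (by filter_upwards [hV] with t ht; exact ht.symm) EventuallyEq.rfl
    have h3 := (isBigO_refl (fun t : ℂ => t) (𝓝[≠] (0 : ℂ))).mul (h2.mul herr)
    refine h3.trans_tendsto (hid.congr' ?_)
    filter_upwards [self_mem_nhdsWithin] with t ht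
    have ht' : t ≠ 0 := ht
    have : t ^ (-(((N : ℤ) + 1) * (M + 1))) * t ^ ((N + 1) * (M + 1)) = 1 := by
      rw [← zpow_natCast, ← zpow_add₀ ht']
      push_cast
      rw [neg_add_cancel, zpow_zero]
    rw [mul_one, this, mul_one]
  have ht1 := herr (W1 M N α β) gW1 err₁ hgW1 hgW1' hs1
  have ht2 := herr (W2 M N α β) gW2 err₂ hgW2 hgW2' hs2
  -- the resonant sum
  have hres : Tendsto (fun t => t ^ (Q + 1) *
      resSum M N ((Q : ℤ) + 1) e (z₀ + t ^ (Q + 1)) (Y₁ t) (Y₂ t)) (𝓝[≠] 0)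
      (𝓝 (resSum M N ((Q : ℤ) + 1) e z₀ (c₁ (-((N : ℤ) + 1))) (c₂ (-((M : ℤ) + 1))))) := by
    have h1 : Tendsto (fun t => resSum M N ((Q : ℤ) + 1) e (z₀ + t ^ (Q + 1)) (p₁ t) (p₂ t))
        (𝓝[≠] 0) (𝓝 (resSum M N ((Q : ℤ) + 1) e z₀ (c₁ (-((N : ℤ) + 1)))
          (c₂ (-((M : ℤ) + 1))))) := by
      unfold resSum
      refine tendsto_finsetSum _ fun q _ => ?_
      split_ifs with hq
      · have k1 : Tendsto (fun t : ℂ => e q (z₀ + t ^ (Q + 1))) (𝓝[≠] 0) (𝓝 (e q z₀)) := by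
          have : ContinuousAt (fun t : ℂ => e q (z₀ + t ^ (Q + 1))) 0 :=
            ContinuousAt.comp' (by rw [hζ0]; exact (he q z₀ hz₀).continuousAt) hζ.continuousAt
          have h := this.continuousWithinAt (s := {0}ᶜ)
          unfold ContinuousWithinAt at h
          simpa using h
        have k2 : Tendsto p₁ (𝓝[≠] 0) (𝓝 (c₁ (-((N : ℤ) + 1)))) := by
          rw [← hp₁0]; exact hp₁a.continuousAt.continuousWithinAt
        have k3 : Tendsto p₂ (𝓝[≠] 0) (𝓝 (c₂ (-((M : ℤ) + 1)))) := by
          rw [← hp₂0]; exact hp₂a.continuousAt.continuousWithinAt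
        exact (k1.mul (k2.zpow₀ _ (Or.inl hc₁))).mul (k3.pow _)
      · exact tendsto_const_nhds
    refine h1.congr' ?_
    filter_upwards [self_mem_nhdsWithin] with t ht
    have ht' : t ≠ 0 := ht
    unfold resSum
    rw [Finset.mul_sum]
    apply Finset.sum_congr rfl
    intro q hq
    split_ifs with hw
    · rw [hY₁, hY₂, trunc_eq _ _ _ t ht', trunc_eq _ _ _ t ht', mul_zpow, mul_pow, ← zpow_mul,
        ← zpow_natCast (t ^ _) (q.1 - 1), ← zpow_mul]
      have hexp : t ^ (Q + 1) * (t ^ (-((N : ℤ) + 1) * ((M : ℤ) - q.2)) *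
          t ^ (-((M : ℤ) + 1) * ((q.1 - 1 : ℕ) : ℤ))) = 1 := by
        rw [← zpow_natCast t (Q + 1), ← zpow_add₀ ht', ← zpow_add₀ ht', ← zpow_zero t]
        congr 1
        rw [Nat.cast_sub (memJ hq).1]
        simp only [wq] at hw
        push_cast
        linear_combination (-1) * hw
      linear_combination (-(e q (z₀ + t ^ (Q + 1)) * p₁ t ^ ((M : ℤ) - q.2)
        * p₂ t ^ (q.1 - 1))) * hexp
    · simp
  have hfin := residue_zero (w := w)
    (b := fun t => ((Q + 1 : ℕ) : ℂ) * t ^ (Q + 1) * a (z₀ + t ^ (Q + 1)) (Y₁ t) (Y₂ t))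
    (σ := fun t => ((Q + 1 : ℕ) : ℂ) * (t ^ (Q + 1) *
        resSum M N ((Q : ℤ) + 1) e (z₀ + t ^ (Q + 1)) (Y₁ t) (Y₂ t)) +
      ((Q + 1 : ℕ) : ℂ) * (t ^ (Q + 1) * E (z₀ + t ^ (Q + 1)) (Y₁ t) (Y₂ t)) +
      t * (W1 M N α β (z₀ + t ^ (Q + 1)) (Y₁ t) (Y₂ t) * err₁ t) +
      t * (W2 M N α β (z₀ + t ^ (Q + 1)) (Y₁ t) (Y₂ t) * err₂ t))
    (S := ((Q + 1 : ℕ) : ℂ) * resSum M N ((Q : ℤ) + 1) e z₀ (c₁ (-((N : ℤ) + 1)))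
        (c₂ (-((M : ℤ) + 1))) + ((Q + 1 : ℕ) : ℂ) * 0 + 0 + 0) hwm ?_ ?_ ?_
  · simp only [mul_zero, add_zero] at hfin
    refine (mul_eq_zero.mp hfin).resolve_left ?_
    exact_mod_cast Nat.succ_ne_zero Q
  · filter_upwards [hζΩ, hY₁ne, self_mem_nhdsWithin] with t k1 k2 k3
    have k3' : t ≠ 0 := k3
    have hdζ : HasDerivAt (fun t : ℂ => z₀ + t ^ (Q + 1)) (((Q + 1 : ℕ) : ℂ) * t ^ Q) t := by
      simpa using (hasDerivAt_pow (Q + 1) t).const_add z₀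
    have hd := Wf_hasPD hα hβ _ _ _ _ _ _ t k1 k2 hdζ
      (trunc_diff (-((N : ℤ) + 1)) c₁ m t k3').hasDerivAt
      (trunc_diff (-((M : ℤ) + 1)) c₂ m t k3').hasDerivAt
    have hd' : deriv w t = _ := hd.deriv
    rw [hd', ← hY₁, ← hY₂]
    have hdd := hD _ k1 (Y₁ t) (Y₂ t) k2
    rw [← DW_eq] at hdd
    simp only [herr₁, herr₂, hw]
    linear_combination ((Q + 1 : ℕ) : ℂ) * t ^ (Q + 1) * hdd
  · have : Tendsto (fun t : ℂ => ((Q + 1 : ℕ) : ℂ) * t ^ (Q + 1) * (t * ga t)) (𝓝[≠] 0)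
        (𝓝 (((Q + 1 : ℕ) : ℂ) * 0 ^ (Q + 1) * (0 * ga 0))) :=
      (tendsto_const_nhds.mul (hid.pow _)).mul
        (hid.mul hga.continuousAt.continuousWithinAt)
    rw [zero_mul, mul_zero] at this
    refine this.congr' ?_
    filter_upwards [hga'] with t ht
    rw [ht]; simp
  · refine (((tendsto_const_nhds.mul hres).add (tendsto_const_nhds.mul ?_)).add ht1).add ht2
    have : Tendsto (fun t : ℂ => t * gE t) (𝓝[≠] 0) (𝓝 (0 * gE 0)) :=
      hid.mul hgE.continuousAt.continuousWithinAt
    rw [zero_mul] at this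
    refine this.congr' ?_
    filter_upwards [hgE', self_mem_nhdsWithin] with t ht h0
    have h0' : t ≠ 0 := h0
    rw [ht]
    have : t ^ (Q + 1) * t ^ (-((Q : ℤ) + 1 - 1)) = t := by
      rw [← zpow_natCast, ← zpow_add₀ h0']
      push_cast
      have : (Q : ℤ) + 1 + -((Q : ℤ) + 1 - 1) = 1 := by ring
      rw [this, zpow_one]
    rw [← mul_assoc, this]

theorem exists_beta (M N : ℕ) (hM : 2 ≤ M) (hN : 2 ≤ N)
    (Ω : Set ℂ) (hΩ : IsOpen Ω)
    (α : ℕ × ℕ → ℂ → ℂ) (hα : ∀ p ∈ idxI' M N, AnalyticOnNhd ℂ (α p) Ω)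
    (hformal : ∀ z₀ ∈ Ω, ∀ c₁L c₂L : ℂ,
      c₁L ^ (M * N - 1) = -(((M * N - 1 : ℕ) : ℂ) ^ (N + 1))⁻¹ →
      c₂L = ((M * N - 1 : ℕ) : ℂ) * c₁L ^ M →
      ∃ c₁ c₂ : ℤ → ℂ,
        c₁ (-((N : ℤ) + 1)) = c₁L ∧ c₂ (-((M : ℤ) + 1)) = c₂L ∧
        IsFormalSolution M N α z₀ c₁ c₂) :
    ∃ β, InvW M N Ω α 0 β := by
  have hMN : 4 ≤ M * N := Nat.mul_le_mul hM hN
  have hres : ∀ (β e : ℕ × ℕ → ℂ → ℂ) (a E : ℂ → ℂ → ℂ → ℂ), (∀ q, AnalyticOnNhd ℂ (β q) Ω) →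
      (∀ q, AnalyticOnNhd ℂ (e q) Ω) → InP M N Ω (-1) a →
      InP M N Ω ((M : ℤ) * N - 1 - 1) E →
      (∀ z ∈ Ω, ∀ y x : ℂ, y ≠ 0 → DW M N α β z y x = a z y x * Wf M N α β z y x +
        resSum M N ((M : ℤ) * N - 1) e z y x + E z y x) →
      ∀ q ∈ idxJ M N, wq M N q = 0 → ∀ z ∈ Ω, e q z = 0 := by
    intro β e a E hβ he ha hE hD q hq hw z hz
    refine resonance_alg M N hM hN (fun q => e q z) ?_ q hq hw
    intro c hc
    have hc0 : c ≠ 0 := by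
      rintro rfl
      rw [zero_pow (by omega)] at hc
      have hQ0 : ((M * N - 1 : ℕ) : ℂ) ≠ 0 := by exact_mod_cast (by omega : M * N - 1 ≠ 0)
      exact neg_ne_zero.2 (inv_ne_zero (pow_ne_zero (N + 1) hQ0)) hc.symm
    obtain ⟨c₁, c₂, h1, h2, h3⟩ := hformal z hz c _ hc rfl
    have := resonance_zero M N hM hN Ω hΩ α hα z hz c₁ c₂ (by rw [h1]; exact hc0) h3 β e a E hβ he ha
      hE hD
    rw [h1, h2] at this
    unfold resSum at this
    simpa only [sub_self] using this
  have key : ∀ k : ℕ, (k : ℤ) ≤ ((N : ℤ) + 1) * (M + 1) - 1 →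
      ∃ β, InvW M N Ω α (((N : ℤ) + 1) * (M + 1) - 1 - k) β := by
    intro k
    induction k with
    | zero => intro _; exact ⟨_, by simpa using InvW.base hα⟩
    | succ k ih =>
      intro hk
      push_cast at hk
      obtain ⟨β, hβ⟩ := ih (by linarith)
      obtain ⟨β', h'⟩ := InvW.step hM hN hα (by linarith) (by linarith [Int.natCast_nonneg k]) hres hβ
      refine ⟨β', ?_⟩
      convert h' using 1
      push_cast; ring
  have hh : (((N + 1) * (M + 1) - 1 : ℕ) : ℤ) = ((N : ℤ) + 1) * (M + 1) - 1 := by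
    rw [Nat.cast_sub (Nat.one_le_iff_ne_zero.2 (by positivity))]; push_cast; ring
  obtain ⟨β, hβ⟩ := key ((N + 1) * (M + 1) - 1) hh.le
  rw [hh, sub_self] at hβ
  exact ⟨β, hβ⟩

theorem curve_gronwall (γ : ℝ → ℂ) (hγ : ContinuousOn γ (Set.Ico 0 1))
    (hlen : eVariationOn γ (Set.Ico 0 1) ≠ ⊤) (V : Set ℂ) (hV : IsOpen V)
    (hγV : ∀ s ∈ Set.Ico (0 : ℝ) 1, γ s ∈ V) (f : ℂ → ℂ) (hf : DifferentiableOn ℂ f V)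
    (K : ℝ) (hK0 : 0 ≤ K)
    (hK : ∀ s ∈ Set.Ico (0 : ℝ) 1, ‖deriv f (γ s)‖ ≤ K * (1 + ‖f (γ s)‖)) :
    ∃ B : ℝ, ∀ s ∈ Set.Ico (0 : ℝ) 1, ‖f (γ s)‖ ≤ B := by
  have hbv : BoundedVariationOn γ (Set.Ico 0 1) := hlen
  have hlbv := hbv.locallyBoundedVariationOn
  have h0 : (0 : ℝ) ∈ Set.Ico (0 : ℝ) 1 := ⟨le_rfl, one_pos⟩
  set L : ℝ → ℝ := variationOnFromTo γ (Set.Ico 0 1) 0 with hL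
  have hLd : ∀ s ∈ Set.Ico (0 : ℝ) 1, ∀ t ∈ Set.Ico (0 : ℝ) 1, s ≤ t → ‖γ t - γ s‖ ≤ L t - L s := by
    intro s hs t ht hst
    have e : L t - L s = variationOnFromTo γ (Set.Ico 0 1) s t := by
      rw [hL, ← variationOnFromTo.add hlbv h0 hs ht, add_sub_cancel_left]
    rw [e, variationOnFromTo.eq_of_le _ _ hst, ← dist_eq_norm, dist_edist]
    apply ENNReal.toReal_mono (hlbv s t hs ht)
    rw [edist_comm]
    exact eVariationOn.edist_le _ ⟨hs, le_rfl, hst⟩ ⟨ht, hst, le_rfl⟩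
  have hloc : ∀ s ∈ Set.Ico (0 : ℝ) 1, ∃ ε > 0, ∀ z ∈ Metric.ball (γ s) ε,
      ∀ w ∈ Metric.ball (γ s) ε, ‖f z - f w‖ ≤ (K + 1) * (1 + ‖f w‖) * ‖z - w‖ := by
    intro s hs
    have hVn := hV.mem_nhds (hγV s hs)
    have hfc : ContinuousAt f (γ s) := (hf.differentiableAt hVn).continuousAt
    have hfd : ContinuousAt (deriv f) (γ s) :=
      ((hf.analyticOnNhd hV).deriv _ (hγV s hs)).continuousAt
    obtain ⟨A, hA1, hA2⟩ : ∃ A, K * (1 + ‖f (γ s)‖) < A ∧ A < (K + 1) * (1 + ‖f (γ s)‖) :=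
      exists_between (by nlinarith [norm_nonneg (f (γ s))])
    have e1 : ∀ᶠ z in 𝓝 (γ s), ‖deriv f z‖ < A :=
      hfd.norm.eventually_lt continuousAt_const (lt_of_le_of_lt (hK s hs) hA1)
    have e2 : ∀ᶠ z in 𝓝 (γ s), A < (K + 1) * (1 + ‖f z‖) :=
      continuousAt_const.eventually_lt
        (continuousAt_const.mul (continuousAt_const.add hfc.norm)) hA2
    obtain ⟨ε, hε, hb⟩ := Metric.eventually_nhds_iff_ball.1 ((e1.and e2).and hVn)
    refine ⟨ε, hε, fun z hz w hw => ?_⟩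
    refine (convex_ball (γ s) ε).norm_image_sub_le_of_norm_deriv_le (f := f)
      (fun x hx => hf.differentiableAt (hV.mem_nhds (hb x hx).2)) (fun x hx => ?_) hw hz
    exact ((hb x hx).1.1.trans (hb w hw).1.2).le
  choose! ε hε hεb using hloc
  set φ : ℝ → ℝ := fun s => (K + 1) * L s - Real.log (1 + ‖f (γ s)‖) with hφ
  have hpair : ∀ u ∈ Set.Ico (0 : ℝ) 1, ∀ s ∈ Set.Ico (0 : ℝ) 1, ∀ t ∈ Set.Ico (0 : ℝ) 1,
      s ≤ t → γ s ∈ Metric.ball (γ u) (ε u) → γ t ∈ Metric.ball (γ u) (ε u) → φ s ≤ φ t := by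
    intro u hu s hs t ht hst h1 h2
    have h3 := hεb u hu _ h2 _ h1
    have h4 := hLd s hs t ht hst
    have hp : 0 < 1 + ‖f (γ s)‖ := by positivity
    have h5 : 1 + ‖f (γ t)‖ ≤ (1 + ‖f (γ s)‖) * Real.exp ((K + 1) * (L t - L s)) := by
      have a1 : ‖f (γ t)‖ ≤ ‖f (γ s)‖ + ‖f (γ t) - f (γ s)‖ := by
        have := norm_add_le (f (γ s)) (f (γ t) - f (γ s))
        simpa using this
      have a2 : (K + 1) * (1 + ‖f (γ s)‖) * ‖γ t - γ s‖ ≤ (K + 1) * (1 + ‖f (γ s)‖) * (L t - L s) :=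
        mul_le_mul_of_nonneg_left h4 (by positivity)
      have a3 := mul_le_mul_of_nonneg_left (Real.add_one_le_exp ((K + 1) * (L t - L s))) hp.le
      linarith
    have h6 := Real.log_le_log (by positivity) h5
    rw [Real.log_mul hp.ne' (Real.exp_ne_zero _), Real.log_exp] at h6
    simp only [hφ]
    linarith
  have hmono : ∀ T ∈ Set.Ico (0 : ℝ) 1, φ 0 ≤ φ T := by
    intro T hT
    have hsub : ∀ x : Set.Icc (0 : ℝ) T, (x : ℝ) ∈ Set.Ico (0 : ℝ) 1 := fun x =>
      ⟨x.2.1, x.2.2.trans_lt hT.2⟩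
    have hc : Continuous (fun x : Set.Icc (0 : ℝ) T => γ x) :=
      hγ.comp_continuous continuous_subtype_val hsub
    obtain ⟨t, t0, tm, ⟨m, hm⟩, ht⟩ := exists_monotone_Icc_subset_open_cover_Icc hT.1
      (c := fun u : Set.Icc (0 : ℝ) T => (fun x : Set.Icc (0 : ℝ) T => γ x) ⁻¹'
        Metric.ball (γ u) (ε u))
      (fun u => Metric.isOpen_ball.preimage hc)
      (fun u _ => Set.mem_iUnion.2 ⟨u, Metric.mem_ball_self (hε _ (hsub u))⟩)
    have : ∀ n, φ 0 ≤ φ (t n) := by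
      intro n
      induction n with
      | zero => rw [t0]
      | succ n ih =>
        obtain ⟨u, hu⟩ := ht n
        have hle := tm (Nat.le_succ n)
        exact ih.trans (hpair u (hsub u) _ (hsub _) _ (hsub _) hle
          (hu ⟨le_rfl, hle⟩) (hu ⟨hle, le_rfl⟩))
    have h := this m
    rwa [hm m le_rfl] at h
  set Λ := (eVariationOn γ (Set.Ico 0 1)).toReal
  refine ⟨Real.exp ((K + 1) * Λ - φ 0), fun s hs => ?_⟩
  have h1 := hmono s hs
  have h2 : L s ≤ Λ := (le_abs_self _).trans (variationOnFromTo.abs_le_eVariationOn hbv)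
  have h3 : Real.log (1 + ‖f (γ s)‖) ≤ (K + 1) * Λ - φ 0 := by
    have : (K + 1) * L s ≤ (K + 1) * Λ := mul_le_mul_of_nonneg_left h2 (by linarith)
    have h4 : φ s = (K + 1) * L s - Real.log (1 + ‖f (γ s)‖) := rfl
    linarith
  have h5 := (Real.log_le_iff_le_exp (by positivity)).1 h3
  linarith

theorem curve_bdd {Ω : Set ℂ} (zinf : ℂ) (hzinf : zinf ∈ Ω)
    (γ' : ℝ → ℂ) (hγc : ContinuousOn γ' (Set.Ico 0 1))
    (hγΩ : γ' '' Set.Ico 0 1 ⊆ Ω)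
    (hendpt : Filter.Tendsto γ' (𝓝[<] (1 : ℝ)) (𝓝 zinf)) (a : ℂ → ℂ) (ha : AnalyticOnNhd ℂ a Ω) :
    ∃ B : ℝ, 0 ≤ B ∧ ∀ s ∈ Set.Ico (0 : ℝ) 1, ‖a (γ' s)‖ ≤ B := by
  have h1 : Tendsto (fun s => ‖a (γ' s)‖) (𝓝[<] (1 : ℝ)) (𝓝 ‖a zinf‖) :=
    ((ha zinf hzinf).continuousAt.norm.tendsto).comp hendpt
  have h2 : ∀ᶠ s in 𝓝[<] (1 : ℝ), ‖a (γ' s)‖ < ‖a zinf‖ + 1 :=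
    h1.eventually (gt_mem_nhds (by linarith))
  obtain ⟨δ, hδ, hb⟩ := (mem_nhdsLT_iff_exists_Ioo_subset).1 h2
  have hc : ContinuousOn (fun s => a (γ' s)) (Set.Icc 0 δ) := by
    intro s hs
    have hs' : s ∈ Set.Ico (0 : ℝ) 1 := ⟨hs.1, hs.2.trans_lt hδ⟩
    have := (ha _ (hγΩ ⟨s, hs', rfl⟩)).continuousAt.comp_continuousWithinAt (hγc s hs')
    exact this.mono fun x hx => ⟨hx.1, hx.2.trans_lt hδ⟩
  obtain ⟨C, hC⟩ := isCompact_Icc.exists_bound_of_continuousOn hc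
  refine ⟨max C (‖a zinf‖ + 1), le_max_of_le_right (by positivity), fun s hs => ?_⟩
  by_cases h : s ≤ δ
  · exact le_max_of_le_left (hC s ⟨hs.1, h⟩)
  · exact le_max_of_le_right (hb ⟨not_le.1 h, hs.2⟩).le

theorem InP.bdd {M N : ℕ} {Ω : Set ℂ} (γ' : ℝ → ℂ) (hγΩ : γ' '' Set.Ico 0 1 ⊆ Ω)
    (hbd : ∀ a : ℂ → ℂ, AnalyticOnNhd ℂ a Ω →
      ∃ B : ℝ, 0 ≤ B ∧ ∀ s ∈ Set.Ico (0 : ℝ) 1, ‖a (γ' s)‖ ≤ B)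
    (y₁ y₂ : ℂ → ℂ) (hne : ∀ s ∈ Set.Ico (0 : ℝ) 1, y₁ (γ' s) ≠ 0)
    (hratiobd : ∀ k l : ℕ, k * (M + 1) ≤ l * (N + 1) →
      ∃ B : ℝ, ∀ s ∈ Set.Ico (0 : ℝ) 1, ‖y₂ (γ' s) ^ k / y₁ (γ' s) ^ l‖ ≤ B)
    {F : ℂ → ℂ → ℂ → ℂ} (hF : InP M N Ω 0 F) :
    ∃ B : ℝ, 0 ≤ B ∧ ∀ s ∈ Set.Ico (0 : ℝ) 1, ‖F (γ' s) (y₁ (γ' s)) (y₂ (γ' s))‖ ≤ B := by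
  induction hF with
  | mono a i j ha h =>
    have hi : i ≤ 0 := by
      by_contra hi
      push Not at hi
      have h1 : 0 < i * ((N : ℤ) + 1) := by positivity
      have h2 : 0 ≤ (j : ℤ) * ((M : ℤ) + 1) := by positivity
      linarith
    obtain ⟨l, rfl⟩ : ∃ l : ℕ, i = -(l : ℤ) := ⟨i.natAbs, by omega⟩
    obtain ⟨A, hA0, hA⟩ := hbd a ha
    obtain ⟨B, hB⟩ := hratiobd j l (by
      have : (j : ℤ) * ((M : ℤ) + 1) ≤ (l : ℤ) * ((N : ℤ) + 1) := by linarith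
      exact_mod_cast this)
    refine ⟨A * max B 0, by positivity, fun s hs => ?_⟩
    have e : a (γ' s) * y₁ (γ' s) ^ (-(l : ℤ)) * y₂ (γ' s) ^ j =
        a (γ' s) * (y₂ (γ' s) ^ j / y₁ (γ' s) ^ l) := by
      rw [zpow_neg, zpow_natCast, div_eq_mul_inv]; ring
    beta_reduce
    rw [e, norm_mul]
    exact mul_le_mul (hA s hs) ((hB s hs).trans (le_max_left _ _)) (norm_nonneg _) hA0
  | zero => exact ⟨0, le_rfl, by simp⟩
  | add F G _ _ h1 h2 =>
    obtain ⟨A, hA0, hA⟩ := h1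
    obtain ⟨B, hB0, hB⟩ := h2
    exact ⟨A + B, by positivity, fun s hs => (norm_add_le _ _).trans (add_le_add (hA s hs) (hB s hs))⟩
  | congr F G _ h h1 =>
    obtain ⟨A, hA0, hA⟩ := h1
    refine ⟨A, hA0, fun s hs => ?_⟩
    rw [← h _ (hγΩ ⟨s, hs, rfl⟩) _ _ (hne s hs)]
    exact hA s hs

/-- Existence of the bounded auxiliary function `W`: if the normalised Hamiltonian
system admits formal series solutions with all admissible leading coefficients at
every point of `Ω`, and `γ'` is a finite-length curve ending in a movable singularity
`z_∞` of a solution `(y₁,y₂)`, on which `1/y₁`, `1/y₂` and all ratios `y₂^k/y₁^l`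
with `l(N+1) − k(M+1) ≥ 0` are bounded, then there are analytic coefficients
`β_{kl}`, `(k,l) ∈ J`, such that
`W = y₁^{M+1} + y₂^{N+1} + ∑_{I'} α_{ij} y₁^i y₂^j + ∑_J β_{kl} y₂^k/y₁^l`
is bounded on the curve. -/
theorem auxiliary_function_bounded (M N : ℕ) (hM : 2 ≤ M) (hMN : M ≤ N)
    (Ω : Set ℂ) (hΩ : IsOpen Ω)
    (α : ℕ × ℕ → ℂ → ℂ) (hα : ∀ p ∈ idxI' M N, AnalyticOnNhd ℂ (α p) Ω)
    (hformal : ∀ z₀ ∈ Ω, ∀ c₁L c₂L : ℂ,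
      c₁L ^ (M * N - 1) = -(((M * N - 1 : ℕ) : ℂ) ^ (N + 1))⁻¹ →
      c₂L = ((M * N - 1 : ℕ) : ℂ) * c₁L ^ M →
      ∃ c₁ c₂ : ℤ → ℂ,
        c₁ (-((N : ℤ) + 1)) = c₁L ∧ c₂ (-((M : ℤ) + 1)) = c₂L ∧
        IsFormalSolution M N α z₀ c₁ c₂)
    -- the curve, ending at the movable singularity `z_∞ ∈ Ω`
    (zinf : ℂ) (hzinf : zinf ∈ Ω)
    (γ' : ℝ → ℂ) (hγc : ContinuousOn γ' (Set.Ico 0 1))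
    (hγΩ : γ' '' Set.Ico 0 1 ⊆ Ω)
    (hlen : eVariationOn γ' (Set.Ico 0 1) ≠ ⊤)
    (hendpt : Filter.Tendsto γ' (𝓝[<] (1 : ℝ)) (𝓝 zinf))
    -- the solution, analytic on a neighbourhood of the curve
    (U : Set ℂ) (hU : IsOpen U) (hUΩ : U ⊆ Ω) (hγU : γ' '' Set.Ico 0 1 ⊆ U)
    (y₁ y₂ : ℂ → ℂ) (hy₁ : AnalyticOnNhd ℂ y₁ U) (hy₂ : AnalyticOnNhd ℂ y₂ U)
    (hode : ∀ z ∈ U,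
      deriv y₁ z = Fn₁ M N α z (y₁ z) (y₂ z) ∧
      deriv y₂ z = Fn₂ M N α z (y₁ z) (y₂ z))
    -- `z_∞` is a movable singularity: no analytic continuation to `z_∞`
    (hsing : ¬ ∃ (V : Set ℂ) (Y₁ Y₂ : ℂ → ℂ), IsOpen V ∧ zinf ∈ V ∧
      AnalyticOnNhd ℂ Y₁ V ∧ AnalyticOnNhd ℂ Y₂ V ∧
      (∀ z ∈ V,
        deriv Y₁ z = Fn₁ M N α z (Y₁ z) (Y₂ z) ∧
        deriv Y₂ z = Fn₂ M N α z (Y₁ z) (Y₂ z)) ∧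
      ∃ δ > (0 : ℝ), ∀ s : ℝ, 1 - δ < s → s < 1 →
        Y₁ (γ' s) = y₁ (γ' s) ∧ Y₂ (γ' s) = y₂ (γ' s))
    -- `1/y₁`, `1/y₂` and the admissible ratios `y₂^k/y₁^l` are bounded on the curve
    (hinvbd : ∃ B : ℝ, ∀ s ∈ Set.Ico (0 : ℝ) 1,
      ‖(y₁ (γ' s))⁻¹‖ ≤ B ∧ ‖(y₂ (γ' s))⁻¹‖ ≤ B)
    (hratiobd : ∀ k l : ℕ, k * (M + 1) ≤ l * (N + 1) →
      ∃ B : ℝ, ∀ s ∈ Set.Ico (0 : ℝ) 1, ‖y₂ (γ' s) ^ k / y₁ (γ' s) ^ l‖ ≤ B) :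
    ∃ β : ℕ × ℕ → ℂ → ℂ,
      (∀ q ∈ idxJ M N, AnalyticOnNhd ℂ (β q) Ω) ∧
      ∃ B : ℝ, ∀ s ∈ Set.Ico (0 : ℝ) 1,
        ‖y₁ (γ' s) ^ (M + 1) + y₂ (γ' s) ^ (N + 1) +
            (∑ p ∈ idxI' M N, α p (γ' s) * y₁ (γ' s) ^ p.1 * y₂ (γ' s) ^ p.2) +
            ∑ q ∈ idxJ M N, β q (γ' s) * y₂ (γ' s) ^ q.1 / y₁ (γ' s) ^ q.2‖ ≤ B := by
  have hN : 2 ≤ N := hM.trans hMN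
  have hbd := fun (a : ℂ → ℂ) ha => curve_bdd (Ω := Ω) zinf hzinf γ' hγc hγΩ hendpt a ha
  have hγV : ∀ s ∈ Set.Ico (0 : ℝ) 1, γ' s ∈ U := fun s hs => hγU ⟨s, hs, rfl⟩
  have hyc : ContinuousOn (fun s => ‖y₁ (γ' s)‖) (Set.Ico 0 1) := fun s hs =>
    ((hy₁ _ (hγV s hs)).continuousAt.comp_continuousWithinAt (hγc s hs)).norm
  by_cases hz : ∃ s ∈ Set.Ico (0 : ℝ) 1, y₁ (γ' s) = 0
  · -- degenerate case
    obtain ⟨s₀, hs₀, hz₀⟩ := hz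
    have hall : ∀ s ∈ Set.Ico (0 : ℝ) 1, y₁ (γ' s) = 0 := by
      by_contra hcon
      push Not at hcon
      obtain ⟨s₁, hs₁, hne⟩ := hcon
      obtain ⟨B, hB⟩ := hinvbd
      have hpos : 0 < ‖y₁ (γ' s₁)‖ := norm_pos_iff.2 hne
      have hB1 := (hB s₁ hs₁).1
      rw [norm_inv] at hB1
      have hBpos : 0 < B := lt_of_lt_of_le (inv_pos.2 hpos) hB1
      have hle : B⁻¹ ≤ ‖y₁ (γ' s₁)‖ := inv_le_of_inv_le₀ hpos hB1
      have hconn := (isPreconnected_Ico (a := (0 : ℝ)) (b := 1)).image _ hyc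
      have hmem := hconn.ordConnected.out (x := 0) ⟨s₀, hs₀, by simp [hz₀]⟩
        ⟨s₁, hs₁, rfl⟩ (show B⁻¹ / 2 ∈ _ from ⟨by positivity, by
          have : 0 < B⁻¹ := inv_pos.2 hBpos
          simp only
          linarith⟩)
      obtain ⟨s, hs, hse⟩ := hmem
      simp only at hse
      have := (hB s hs).1
      rw [norm_inv, hse, inv_div, div_inv_eq_mul] at this
      linarith
    refine ⟨fun _ _ => 0, fun _ _ => analyticOnNhd_const, ?_⟩
    by_cases hsub : (γ' '' Set.Ico 0 1).Subsingleton
    · refine ⟨‖y₁ (γ' 0) ^ (M + 1) + y₂ (γ' 0) ^ (N + 1) +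
            (∑ p ∈ idxI' M N, α p (γ' 0) * y₁ (γ' 0) ^ p.1 * y₂ (γ' 0) ^ p.2)‖, fun s hs => ?_⟩
      · have : γ' s = γ' 0 := hsub ⟨s, hs, rfl⟩ ⟨0, ⟨le_rfl, one_pos⟩, rfl⟩
        rw [this]; simp
    · have hpre := ((isPreconnected_Ico (a := (0 : ℝ)) (b := 1)).image _ hγc).preperfect_of_nontrivial
        (Set.not_subsingleton_iff.1 hsub)
      have hFn : ∀ s ∈ Set.Ico (0 : ℝ) 1, Fn₁ M N α (γ' s) 0 (y₂ (γ' s)) = 0 := by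
        intro s hs
        have hacc := accPt_iff_frequently_nhdsNE.1 (hpre (γ' s) ⟨s, hs, rfl⟩)
        have hfr : ∃ᶠ z in 𝓝[≠] (γ' s), y₁ z = 0 := by
          refine hacc.mono ?_
          rintro z ⟨t, ht, rfl⟩
          exact hall t ht
        have hev := (hy₁ _ (hγV s hs)).frequently_zero_iff_eventually_zero.1 hfr
        have hd : deriv y₁ (γ' s) = 0 := by
          have h : y₁ =ᶠ[𝓝 (γ' s)] fun _ => 0 := hev
          rw [h.deriv_eq]; simp
        rw [(hode _ (hγV s hs)).1, hall s hs] at hd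
        exact hd
      have hA : ∀ p, ∃ A : ℝ, 0 ≤ A ∧ (p ∈ idxI' M N → ∀ s ∈ Set.Ico (0 : ℝ) 1, ‖α p (γ' s)‖ ≤ A) := by
        intro p
        by_cases hp : p ∈ idxI' M N
        · obtain ⟨A, h0, h⟩ := hbd _ (hα p hp)
          exact ⟨A, h0, fun _ => h⟩
        · exact ⟨0, le_rfl, fun h => absurd h hp⟩
      choose A hA0 hA using hA
      have h0p : ∀ i : ℕ, ‖(0 : ℂ) ^ i‖ ≤ 1 := fun i => by
        rw [norm_pow, norm_zero]; exact pow_le_one₀ le_rfl zero_le_one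
      set X : ℝ := 1 + ∑ p ∈ idxI' M N, (p.2 : ℝ) * A p with hX
      have hSnn : 0 ≤ ∑ p ∈ idxI' M N, (p.2 : ℝ) * A p :=
        Finset.sum_nonneg fun p _ => mul_nonneg (Nat.cast_nonneg _) (hA0 p)
      have hxb : ∀ s ∈ Set.Ico (0 : ℝ) 1, ‖y₂ (γ' s)‖ ≤ X := by
        intro s hs
        by_cases h1 : ‖y₂ (γ' s)‖ ≤ 1
        · linarith
        push Not at h1
        have h := hFn s hs
        unfold Fn₁ at h
        set x := y₂ (γ' s)
        have h2 : ‖((N : ℂ) + 1) * x ^ N‖ ≤ ∑ p ∈ idxI' M N, (p.2 : ℝ) * A p * ‖x‖ ^ (N - 1) := by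
          rw [eq_neg_of_add_eq_zero_left h, norm_neg]
          refine norm_sum_le_of_le _ fun p hp => ?_
          rw [norm_mul, norm_mul, norm_mul, norm_pow x, Complex.norm_natCast]
          have hp2 : p.2 ≤ N := by
            have := memI' hp
            by_contra hcon
            push Not at hcon
            have h4 : (N : ℤ) + 1 ≤ p.2 := by exact_mod_cast hcon
            have h5 : ((N : ℤ) + 1) * (M + 1) ≤ p.2 * ((M : ℤ) + 1) :=
              mul_le_mul_of_nonneg_right h4 (by positivity)
            have h6 : 0 ≤ (p.1 : ℤ) * ((N : ℤ) + 1) := by positivity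
            linarith
          have h4 : (p.2 : ℝ) * ‖α p (γ' s)‖ * ‖(0 : ℂ) ^ p.1‖ ≤ (p.2 : ℝ) * A p * 1 :=
            mul_le_mul (mul_le_mul_of_nonneg_left (hA p hp s hs) (Nat.cast_nonneg _)) (h0p _)
              (norm_nonneg _) (mul_nonneg (Nat.cast_nonneg _) (hA0 p))
          rw [mul_one] at h4
          exact mul_le_mul h4 (pow_le_pow_right₀ h1.le (by omega)) (by positivity)
            (mul_nonneg (Nat.cast_nonneg _) (hA0 p))
        rw [← Finset.sum_mul, norm_mul, norm_pow] at h2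
        have h3 : ‖((N : ℂ) + 1)‖ = (N : ℝ) + 1 := by
          have := Complex.norm_natCast (N + 1)
          push_cast at this
          exact this
        obtain ⟨n, rfl⟩ : ∃ n, N = n + 1 := ⟨N - 1, by omega⟩
        rw [h3, pow_succ, Nat.add_sub_cancel] at h2
        have hxp : 0 < ‖x‖ ^ n := by positivity
        have h4 : (((n + 1 : ℕ) : ℝ) + 1) * ‖x‖ ≤ ∑ p ∈ idxI' M (n + 1), (p.2 : ℝ) * A p := by
          refine le_of_mul_le_mul_right ?_ hxp
          linarith
        have h5 : ‖x‖ ≤ (((n + 1 : ℕ) : ℝ) + 1) * ‖x‖ :=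
          le_mul_of_one_le_left (norm_nonneg _) (by linarith [Nat.cast_nonneg (α := ℝ) (n + 1)])
        linarith
      refine ⟨X ^ (N + 1) + ∑ p ∈ idxI' M N, A p * X ^ p.2, fun s hs => ?_⟩
      rw [hall s hs]
      simp only [zero_mul, zero_div, Finset.sum_const_zero, add_zero]
      rw [zero_pow (Nat.succ_ne_zero M), zero_add]
      refine (norm_add_le _ _).trans (add_le_add ?_ (norm_sum_le_of_le _ fun p hp => ?_))
      · rw [norm_pow]; exact pow_le_pow_left₀ (norm_nonneg _) (hxb s hs) _
      · rw [norm_mul, norm_mul, norm_pow (y₂ _)]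
        have h4 : ‖α p (γ' s)‖ * ‖(0 : ℂ) ^ p.1‖ ≤ A p * 1 :=
          mul_le_mul (hA p hp s hs) (h0p _) (norm_nonneg _) (hA0 p)
        rw [mul_one] at h4
        exact mul_le_mul h4 (pow_le_pow_left₀ (norm_nonneg _) (hxb s hs) _) (by positivity) (hA0 p)
  · -- main case
    push Not at hz
    obtain ⟨β, hβ, a, E, ha, hE, hD⟩ := exists_beta M N hM hN Ω hΩ α hα hformal
    obtain ⟨Ka, hKa0, hKa⟩ := (ha.le (by norm_num : (-1 : ℤ) ≤ 0)).bdd γ' hγΩ hbd y₁ y₂ hz hratiobd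
    obtain ⟨Ke, hKe0, hKe⟩ := hE.bdd γ' hγΩ hbd y₁ y₂ hz hratiobd
    refine ⟨β, fun q _ => hβ q, ?_⟩
    have hder : ∀ z ∈ U, y₁ z ≠ 0 → HasDerivAt (fun z => Wf M N α β z (y₁ z) (y₂ z))
        (DW M N α β z (y₁ z) (y₂ z)) z := by
      intro z hzU hy
      have h1 := (hy₁ z hzU).differentiableAt.hasDerivAt
      have h2 := (hy₂ z hzU).differentiableAt.hasDerivAt
      rw [(hode z hzU).1] at h1
      rw [(hode z hzU).2] at h2
      have := Wf_hasPD hα hβ (fun z => z) y₁ y₂ 1 _ _ z (hUΩ hzU) hy (hasDerivAt_id z) h1 h2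
      refine this.congr_deriv ?_
      rw [← DW_eq, mul_one]
    have hVo : IsOpen (U ∩ y₁ ⁻¹' {0}ᶜ) :=
      hy₁.continuousOn.isOpen_inter_preimage hU isOpen_compl_singleton
    obtain ⟨B, hB⟩ := curve_gronwall γ' hγc hlen (U ∩ y₁ ⁻¹' {0}ᶜ) hVo
      (fun s hs => ⟨hγV s hs, hz s hs⟩) (fun z => Wf M N α β z (y₁ z) (y₂ z))
      (fun z hz => (hder z hz.1 hz.2).differentiableAt.differentiableWithinAt) (Ka + Ke)
      (by positivity) (by
        intro s hs
        rw [(hder _ (hγV s hs) (hz s hs)).deriv, hD _ (hγΩ ⟨s, hs, rfl⟩) _ _ (hz s hs)]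
        refine (norm_add_le _ _).trans ?_
        rw [norm_mul]
        have h1 := hKa s hs
        have h2 := hKe s hs
        have h3 := mul_le_mul_of_nonneg_right h1
          (norm_nonneg (Wf M N α β (γ' s) (y₁ (γ' s)) (y₂ (γ' s))))
        have h4 := mul_nonneg hKe0 (norm_nonneg (Wf M N α β (γ' s) (y₁ (γ' s)) (y₂ (γ' s))))
        linarith)
    refine ⟨B, fun s hs => ?_⟩
    have h := hB s hs
    unfold Wf at h
    convert h using 3
    refine Finset.sum_congr rfl fun q _ => ?_
    rw [zpow_neg, zpow_natCast, div_eq_mul_inv]; ring
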